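/- Let (R,m) be a Noetherian local ring admitting a dualizing module, and let C be a semidualizing R-module with finite injective dimension (i.e. C is dualizing). Then for every ideal a of R such that R is relative Cohen-Macaulay with respect to a with ht_R(a) = n, the G_C-injective dimension of H_a^n(R) is finite; in fact H_a^n(R) has finite C-injective dimension equal to id_R(C) − n. -/

import Mathlib

/-!
Common definitions: semidualizing modules, `C`-injective modules and dimensions,
`G_C`-injective modules, Bass/Auslander classes, relative Cohen-Macaulayness,
Cohen-Macaulay and Gorenstein local rings, trivial extensions, ideal torsion.
-/

noncomputable section

open CategoryTheory TensorProduct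

universe u

variable (R : Type u) [CommRing R]

/-- An `R`-module `M` is `C`-injective if it is isomorphic to `Hom_R(C, I)`
for some injective `R`-module `I`. -/
def IsCInjective (C M : ModuleCat.{u} R) : Prop :=
  ∃ I : ModuleCat.{u} R, Module.Injective R I ∧ Nonempty (M ≃ₗ[R] (C →ₗ[R] I))

/-- `HasCoresDimLE R P n M` : the module `M` admits a coresolution of length at most `n`
by modules satisfying the property `P`. -/
def HasCoresDimLE (P : ModuleCat.{u} R → Prop) : ℕ → ModuleCat.{u} R → Prop
  | 0, M => Subsingleton M ∨ P M
  | n + 1, M => Subsingleton M ∨ ∃ (X : ModuleCat.{u} R) (f : M →ₗ[R] X),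
      P X ∧ Function.Injective f ∧
        HasCoresDimLE P n (ModuleCat.of R (X ⧸ LinearMap.range f))

/-- The coresolution dimension of `M` with respect to the class of modules satisfying `P`,
as an element of `ℕ∞` (`⊤` meaning no finite coresolution exists). -/
def coresDim (P : ModuleCat.{u} R → Prop) (M : ModuleCat.{u} R) : ℕ∞ :=
  sInf {d : ℕ∞ | ∃ n : ℕ, d = n ∧ HasCoresDimLE R P n M}

/-- The `C`-injective dimension of `M`. -/
def cinjDim (C M : ModuleCat.{u} R) : ℕ∞ :=
  coresDim R (IsCInjective R C) M

/-- The injective dimension of `M`. -/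
def injDim (M : ModuleCat.{u} R) : ℕ∞ :=
  coresDim R (fun N => Module.Injective R N) M

/-- A finitely generated `R`-module `C` is semidualizing if the natural map
`R → Hom_R(C,C)` is bijective and `Ext_R^i(C,C) = 0` for all `i ≥ 1`. -/
def IsSemidualizing (C : ModuleCat.{u} R) : Prop :=
  Module.Finite R C ∧ Function.Bijective (LinearMap.lsmul R C) ∧
    ∀ i : ℕ, 1 ≤ i →
      Subsingleton (((Ext R (ModuleCat.{u} R) i).obj (Opposite.op C)).obj C)

/-- A dualizing module is a semidualizing module of finite injective dimension. -/
def IsDualizing (C : ModuleCat.{u} R) : Prop :=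
  IsSemidualizing R C ∧ injDim R C ≠ ⊤

/-- A complete `I_C I`-resolution: an exact complex `Y` (with `d i : Y (i+1) → Y i`)
which stays exact after applying `Hom_R(I, -)` for every `C`-injective `I`, whose terms
in positive degrees are `C`-injective and whose terms in degrees `≤ 0` are injective. -/
structure CompleteICIResolution (C : ModuleCat.{u} R) where
  Y : ℤ → ModuleCat.{u} R
  d : (i : ℤ) → (Y (i + 1) →ₗ[R] Y i)
  exact : ∀ i : ℤ, Function.Exact (d (i + 1)) (d i)
  cinj_pos : ∀ i : ℤ, 0 < i → IsCInjective R C (Y i)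
  inj_nonpos : ∀ i : ℤ, i ≤ 0 → Module.Injective R (Y i)
  homExact : ∀ I : ModuleCat.{u} R, IsCInjective R C I → ∀ i : ℤ,
    Function.Exact (fun f : I →ₗ[R] Y (i + 1 + 1) => (d (i + 1)).comp f)
      (fun f : I →ₗ[R] Y (i + 1) => (d i).comp f)

/-- A module is `G_C`-injective if it is the kernel of the degree-`0` differential of some
complete `I_C I`-resolution. -/
def IsGCInjective (C M : ModuleCat.{u} R) : Prop :=
  ∃ res : CompleteICIResolution R C,
    Nonempty (M ≃ₗ[R] ↥(LinearMap.ker (res.d (-1))))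

/-- The `G_C`-injective dimension of `M`. -/
def gcinjDim (C M : ModuleCat.{u} R) : ℕ∞ :=
  coresDim R (IsGCInjective R C) M

/-- `M` is relative Cohen-Macaulay with respect to `a`: there is exactly one
non-vanishing local cohomology module of `M` with respect to `a`. -/
def IsRelativeCM (a : Ideal R) (M : ModuleCat.{u} R) : Prop :=
  ∃! n : ℕ, Nontrivial ((localCohomology a n).obj M)

/-- `M` is relative Cohen-Macaulay with respect to `a`, with (unique) non-vanishing
local cohomology in degree `n`. -/
def IsRelativeCMAt (a : Ideal R) (n : ℕ) (M : ModuleCat.{u} R) : Prop :=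
  Nontrivial ((localCohomology a n).obj M) ∧
    ∀ i : ℕ, i ≠ n → Subsingleton ((localCohomology a i).obj M)

/-- The cohomological dimension `cd(a, M)`: the largest `i` with `H_a^i(M) ≠ 0`. -/
def lcCohomDim (a : Ideal R) (M : ModuleCat.{u} R) : ℕ :=
  sSup {i : ℕ | Nontrivial ((localCohomology a i).obj M)}

/-- The grade `grade(a, M)`: the least `i` with `H_a^i(M) ≠ 0`. -/
def lcGrade (a : Ideal R) (M : ModuleCat.{u} R) : ℕ :=
  sInf {i : ℕ | Nontrivial ((localCohomology a i).obj M)}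

/-- A Noetherian local ring is Cohen-Macaulay iff `H_m^i(R) = 0` for all `i ≠ dim R`
(Grothendieck's characterization, taken here as the definition). -/
def IsCohenMacaulayLocalRing (S : Type u) [CommRing S] [IsLocalRing S] : Prop :=
  ∀ i : ℕ, (i : WithBot ℕ∞) ≠ ringKrullDim S →
    Subsingleton ((localCohomology (IsLocalRing.maximalIdeal S) i).obj (ModuleCat.of S S))

/-- A local ring is Gorenstein if it has finite injective dimension over itself. -/
def IsGorensteinLocalRing (S : Type u) [CommRing S] : Prop :=
  injDim S (ModuleCat.of S S) ≠ ⊤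

/-- The `a`-torsion submodule `Γ_a(M)` of `M`. -/
def idealTorsion (a : Ideal R) (M : Type u) [AddCommGroup M] [Module R M] :
    Submodule R M :=
  ⨆ n : ℕ, Submodule.torsionBySet R M ((a ^ n : Ideal R) : Set R)

/-- The Krull dimension of a module, `dim_S N = dim (S / ann_S N)`. -/
def moduleKrullDim (S : Type u) [CommRing S] (N : Type u) [AddCommGroup N] [Module S N] :
    WithBot ℕ∞ :=
  ringKrullDim (S ⧸ Module.annihilator S N)

/-- `ht_M(a) = inf { dim_{R_p} M_p  |  p ∈ Supp (M / a M) }`. -/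
def heightWRT (a : Ideal R) (M : Type u) [AddCommGroup M] [Module R M] : WithBot ℕ∞ :=
  ⨅ (p : PrimeSpectrum R) (_ : p ∈ Module.support R (M ⧸ (a • (⊤ : Submodule R M)))),
    moduleKrullDim (Localization.AtPrime p.asIdeal) (LocalizedModule p.asIdeal.primeCompl M)

/-- Membership in the Bass class `B_C(R)`. -/
def MemBassClass (C M : ModuleCat.{u} R) : Prop :=
  (∀ i : ℕ, 1 ≤ i →
      Subsingleton (((Ext R (ModuleCat.{u} R) i).obj (Opposite.op C)).obj M)) ∧
  (∀ i : ℕ, 1 ≤ i →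
      Subsingleton (((Tor (ModuleCat.{u} R) i).obj C).obj (ModuleCat.of R (C →ₗ[R] M)))) ∧
  Function.Bijective
    (TensorProduct.lift ((LinearMap.id : (C →ₗ[R] M) →ₗ[R] (C →ₗ[R] M)).flip))

/-- Membership in the Auslander class `A_C(R)`. -/
def MemAuslanderClass (C M : ModuleCat.{u} R) : Prop :=
  (∀ i : ℕ, 1 ≤ i →
      Subsingleton (((Tor (ModuleCat.{u} R) i).obj C).obj M)) ∧
  (∀ i : ℕ, 1 ≤ i →
      Subsingleton (((Ext R (ModuleCat.{u} R) i).obj (Opposite.op C)).obj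
        (ModuleCat.of R (↥C ⊗[R] ↥M)))) ∧
  Function.Bijective ((TensorProduct.mk R ↥C ↥M).flip)

/-- `HasResDimLE R P n M` : `M` admits a resolution of length at most `n`
by modules satisfying `P`. -/
def HasResDimLE (P : ModuleCat.{u} R → Prop) : ℕ → ModuleCat.{u} R → Prop
  | 0, M => Subsingleton M ∨ P M
  | n + 1, M => Subsingleton M ∨ ∃ (X : ModuleCat.{u} R) (f : X →ₗ[R] M),
      P X ∧ Function.Surjective f ∧
        HasResDimLE P n (ModuleCat.of R ↥(LinearMap.ker f))

/-- The projective dimension of `M`. -/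
def projDim (M : ModuleCat.{u} R) : ℕ∞ :=
  sInf {d : ℕ∞ | ∃ n : ℕ, d = n ∧ HasResDimLE R (fun N => Module.Projective R N) n M}

/-- The first projection of the trivial extension `R ⋉ C`, as a ring homomorphism. -/
def trivExtFst (C : Type u) [AddCommGroup C] [Module R C] [Module Rᵐᵒᵖ C]
    [IsCentralScalar R C] : TrivSqZeroExt R C →+* R where
  toFun := TrivSqZeroExt.fst
  map_one' := TrivSqZeroExt.fst_one (R := R) (M := C)
  map_mul' := TrivSqZeroExt.fst_mul
  map_zero' := TrivSqZeroExt.fst_zero (R := R) (M := C)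
  map_add' := TrivSqZeroExt.fst_add

/-- The ideal `a ⊕ C` of the trivial extension `R ⋉ C`. -/
def trivExtIdeal (a : Ideal R) (C : Type u) [AddCommGroup C] [Module R C] [Module Rᵐᵒᵖ C]
    [IsCentralScalar R C] : Ideal (TrivSqZeroExt R C) :=
  Ideal.comap (trivExtFst R C) a

/-- An `R`-module `M`, viewed as a module over the trivial extension `R ⋉ C` via the
natural surjection `R ⋉ C → R`. -/
def trivExtModuleCat (C : Type u) [AddCommGroup C] [Module R C] [Module Rᵐᵒᵖ C]
    [IsCentralScalar R C] (M : Type u) [AddCommGroup M] [Module R M] :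
    ModuleCat.{u} (TrivSqZeroExt R C) :=
  letI := Module.compHom M (trivExtFst R C)
  ModuleCat.of (TrivSqZeroExt R C) M

end

noncomputable section

namespace RelCM

open CategoryTheory Abelian TensorProduct

universe u

set_option autoImplicit false

section

variable {R : Type u} [CommRing R]

/-- `Ext_R^i(X, Y)` for unbundled modules. -/
abbrev MExt (R : Type u) [CommRing R] (X Y : Type u) [AddCommGroup X] [Module R X]
    [AddCommGroup Y] [Module R Y] (i : ℕ) : Type u :=
  CategoryTheory.Abelian.Ext.{u} (ModuleCat.of R X) (ModuleCat.of R Y) i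

/-- A short exact sequence of modules. -/
structure SES {A B D : Type u} [AddCommGroup A] [Module R A] [AddCommGroup B] [Module R B]
    [AddCommGroup D] [Module R D] (f : A →ₗ[R] B) (g : B →ₗ[R] D) : Prop where
  inj : Function.Injective f
  surj : Function.Surjective g
  exact : Function.Exact f g

section

variable {X X' X'' Y Y' Y'' : Type u} [AddCommGroup X] [Module R X] [AddCommGroup X']
  [Module R X'] [AddCommGroup X''] [Module R X''] [AddCommGroup Y] [Module R Y]
  [AddCommGroup Y'] [Module R Y'] [AddCommGroup Y''] [Module R Y'']

/-- Precomposition on `Ext`. -/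
def pre (Y : Type u) [AddCommGroup Y] [Module R Y] (f : X →ₗ[R] X') (i : ℕ) :
    MExt R X' Y i →ₗ[R] MExt R X Y i :=
  (Abelian.Ext.mk₀ (ModuleCat.ofHom f)).precompOfLinear R (ModuleCat.of R Y) (zero_add i)

/-- Postcomposition on `Ext`. -/
def post (X : Type u) [AddCommGroup X] [Module R X] (g : Y →ₗ[R] Y') (i : ℕ) :
    MExt R X Y i →ₗ[R] MExt R X Y' i :=
  (Abelian.Ext.mk₀ (ModuleCat.ofHom g)).postcompOfLinear R (ModuleCat.of R X) (add_zero i)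

lemma pre_apply (f : X →ₗ[R] X') (i : ℕ) (x : MExt R X' Y i) :
    pre Y f i x = (Abelian.Ext.mk₀ (ModuleCat.ofHom f)).comp x (zero_add i) := rfl

lemma post_apply (g : Y →ₗ[R] Y') (i : ℕ) (x : MExt R X Y i) :
    post X g i x = x.comp (Abelian.Ext.mk₀ (ModuleCat.ofHom g)) (add_zero i) := rfl

lemma pre_comp (f : X →ₗ[R] X') (f' : X' →ₗ[R] X'') (i : ℕ) (x : MExt R X'' Y i) :
    pre Y (f' ∘ₗ f) i x = pre Y f i (pre Y f' i x) := by
  simp only [pre_apply, ModuleCat.ofHom_comp, Abelian.Ext.mk₀_comp_mk₀_assoc]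

lemma post_comp (g : Y →ₗ[R] Y') (g' : Y' →ₗ[R] Y'') (i : ℕ) (x : MExt R X Y i) :
    post X (g' ∘ₗ g) i x = post X g' i (post X g i x) := by
  simp only [post_apply, ModuleCat.ofHom_comp]
  rw [Abelian.Ext.comp_assoc_of_third_deg_zero, Abelian.Ext.mk₀_comp_mk₀]

lemma pre_post (f : X →ₗ[R] X') (g : Y →ₗ[R] Y') (i : ℕ) (x : MExt R X' Y i) :
    pre Y' f i (post X' g i x) = post X g i (pre Y f i x) := by
  simp only [pre_apply, post_apply]
  rw [Abelian.Ext.comp_assoc_of_third_deg_zero]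

lemma pre_smul_id (r : R) (i : ℕ) (x : MExt R X Y i) :
    pre Y (r • LinearMap.id : X →ₗ[R] X) i x = r • x := by
  rw [pre_apply]
  have : ModuleCat.ofHom (r • LinearMap.id : X →ₗ[R] X) = r • 𝟙 (ModuleCat.of R X) := rfl
  rw [this, Abelian.Ext.mk₀_smul, Abelian.Ext.smul_comp, Abelian.Ext.mk₀_id_comp]

lemma post_smul_id (r : R) (i : ℕ) (x : MExt R X Y i) :
    post X (r • LinearMap.id : Y →ₗ[R] Y) i x = r • x := by
  rw [post_apply, Abelian.Ext.smul_eq_comp_mk₀]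
  rfl

lemma pre_id (i : ℕ) (x : MExt R X Y i) : pre Y (LinearMap.id : X →ₗ[R] X) i x = x := by
  simpa using pre_smul_id (1 : R) i x

lemma post_id (i : ℕ) (x : MExt R X Y i) : post X (LinearMap.id : Y →ₗ[R] Y) i x = x := by
  simpa using post_smul_id (1 : R) i x

lemma pre_zero (i : ℕ) (x : MExt R X' Y i) : pre Y (0 : X →ₗ[R] X') i x = 0 := by
  rw [pre_apply, ModuleCat.ofHom_zero, Abelian.Ext.mk₀_zero, Abelian.Ext.zero_comp]

lemma post_zero (i : ℕ) (x : MExt R X Y i) : post X (0 : Y →ₗ[R] Y') i x = 0 := by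
  rw [post_apply, ModuleCat.ofHom_zero, Abelian.Ext.mk₀_zero, Abelian.Ext.comp_zero]

/-- `Ext` is invariant under isomorphism in the first variable. -/
def preEquiv (Y : Type u) [AddCommGroup Y] [Module R Y] (e : X ≃ₗ[R] X') (i : ℕ) :
    MExt R X' Y i ≃ₗ[R] MExt R X Y i :=
  LinearEquiv.ofLinearMap (pre Y e.toLinearMap i) (pre Y e.symm.toLinearMap i)
    (by ext x; simp [← pre_comp, pre_id]) (by ext x; simp [← pre_comp, pre_id])

/-- `Ext` is invariant under isomorphism in the second variable. -/
def postEquiv (X : Type u) [AddCommGroup X] [Module R X] (e : Y ≃ₗ[R] Y') (i : ℕ) :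
    MExt R X Y i ≃ₗ[R] MExt R X Y' i :=
  LinearEquiv.ofLinearMap (post X e.toLinearMap i) (post X e.symm.toLinearMap i)
    (by ext x; simp [← post_comp, post_id]) (by ext x; simp [← post_comp, post_id])

/-- `Ext^0` is `Hom`. -/
def ext0 (X Y : Type u) [AddCommGroup X] [Module R X] [AddCommGroup Y] [Module R Y] :
    MExt R X Y 0 ≃ₗ[R] (X →ₗ[R] Y) :=
  (Abelian.Ext.linearEquiv₀ (R := R)).trans ModuleCat.homLinearEquiv

lemma ext0_pre (f : X →ₗ[R] X') (x : MExt R X' Y 0) :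
    ext0 X Y (pre Y f 0 x) = (ext0 X' Y x) ∘ₗ f := by
  obtain ⟨h, rfl⟩ := (Abelian.Ext.linearEquiv₀ (R := R)).symm.surjective x
  have : pre Y f 0 ((Abelian.Ext.linearEquiv₀ (R := R)).symm h) =
      (Abelian.Ext.linearEquiv₀ (R := R)).symm (ModuleCat.ofHom f ≫ h) := by
    simp [pre_apply]
  rw [this]
  simp only [ext0, LinearEquiv.trans_apply, LinearEquiv.apply_symm_apply]
  rfl

lemma ext0_post (g : Y →ₗ[R] Y') (x : MExt R X Y 0) :
    ext0 X Y' (post X g 0 x) = g ∘ₗ (ext0 X Y x) := by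
  obtain ⟨h, rfl⟩ := (Abelian.Ext.linearEquiv₀ (R := R)).symm.surjective x
  have : post X g 0 ((Abelian.Ext.linearEquiv₀ (R := R)).symm h) =
      (Abelian.Ext.linearEquiv₀ (R := R)).symm (h ≫ ModuleCat.ofHom g) := by
    simp [post_apply]
  rw [this]
  simp only [ext0, LinearEquiv.trans_apply, LinearEquiv.apply_symm_apply]
  rfl

end

namespace SES

variable {A B D : Type u} [AddCommGroup A] [Module R A] [AddCommGroup B] [Module R B]
    [AddCommGroup D] [Module R D] {f : A →ₗ[R] B} {g : B →ₗ[R] D}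

/-- The underlying short complex. -/
abbrev cx (h : SES f g) : ShortComplex (ModuleCat.{u} R) :=
  ShortComplex.mk (ModuleCat.ofHom f) (ModuleCat.ofHom g)
    (by ext x; exact (h.exact (f x)).2 ⟨x, rfl⟩)

lemma shortExact (h : SES f g) : h.cx.ShortExact :=
  ModuleCat.shortComplex_shortExact _ h.exact h.inj h.surj

variable (X : Type u) [AddCommGroup X] [Module R X]

/-- Connecting map for the covariant long exact sequence. -/
def dCov (h : SES f g) (i : ℕ) : MExt R X D i →ₗ[R] MExt R X A (i + 1) :=
  h.shortExact.extClass.postcompOfLinear R (ModuleCat.of R X) rfl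

/-- Connecting map for the contravariant long exact sequence. -/
def dCon (h : SES f g) (i : ℕ) : MExt R A X i →ₗ[R] MExt R D X (i + 1) :=
  h.shortExact.extClass.precompOfLinear R (ModuleCat.of R X) (add_comm 1 i)

variable {X}

lemma dCov_apply (h : SES f g) (i : ℕ) (x : MExt R X D i) :
    h.dCov X i x = x.comp h.shortExact.extClass rfl := rfl

lemma cov_exact₁ (h : SES f g) {i : ℕ} {x : MExt R X A (i + 1)} (hx : post X f (i + 1) x = 0) :
    ∃ y, h.dCov X i y = x :=
  Abelian.Ext.covariant_sequence_exact₁ _ h.shortExact x hx rfl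

lemma cov_exact₂ (h : SES f g) {i : ℕ} {x : MExt R X B i} (hx : post X g i x = 0) :
    ∃ y, post X f i y = x :=
  Abelian.Ext.covariant_sequence_exact₂ _ h.shortExact x hx

lemma cov_exact₃ (h : SES f g) {i : ℕ} {x : MExt R X D i} (hx : h.dCov X i x = 0) :
    ∃ y, post X g i y = x :=
  Abelian.Ext.covariant_sequence_exact₃ _ h.shortExact x rfl hx

lemma con_exact₁ (h : SES f g) {i : ℕ} {x : MExt R A X i} (hx : h.dCon X i x = 0) :
    ∃ y, pre X f i y = x :=
  Abelian.Ext.contravariant_sequence_exact₁ h.shortExact _ x (add_comm 1 i) hx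

lemma con_exact₂ (h : SES f g) {i : ℕ} {x : MExt R B X i} (hx : pre X f i x = 0) :
    ∃ y, pre X g i y = x :=
  Abelian.Ext.contravariant_sequence_exact₂ h.shortExact _ x hx

lemma con_exact₃ (h : SES f g) {i : ℕ} {x : MExt R D X (i + 1)} (hx : pre X g (i + 1) x = 0) :
    ∃ y, h.dCon X i y = x :=
  Abelian.Ext.contravariant_sequence_exact₃ h.shortExact _ x hx (add_comm 1 i)

lemma pre_dCov (h : SES f g) {X' : Type u} [AddCommGroup X'] [Module R X'] (φ : X' →ₗ[R] X)
    (i : ℕ) (x : MExt R X D i) :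
    pre A φ (i + 1) (h.dCov X i x) = h.dCov X' i (pre D φ i x) := by
  simp only [pre_apply, dCov_apply]
  rw [Abelian.Ext.comp_assoc]
  all_goals omega

lemma dCov_post (h : SES f g) {A' B' D' : Type u} [AddCommGroup A'] [Module R A']
    [AddCommGroup B'] [Module R B'] [AddCommGroup D'] [Module R D'] {f' : A' →ₗ[R] B'}
    {g' : B' →ₗ[R] D'} (h' : SES f' g') (α : A →ₗ[R] A') (β : B →ₗ[R] B') (γ : D →ₗ[R] D')
    (h₁ : β ∘ₗ f = f' ∘ₗ α) (h₂ : γ ∘ₗ g = g' ∘ₗ β) (i : ℕ) (x : MExt R X D i) :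
    post X α (i + 1) (h.dCov X i x) = h'.dCov X i (post X γ i x) := by
  simp only [post_apply, dCov_apply]
  let φ : h.cx ⟶ h'.cx :=
    { τ₁ := ModuleCat.ofHom α
      τ₂ := ModuleCat.ofHom β
      τ₃ := ModuleCat.ofHom γ
      comm₁₂ := by
        simp only [← ModuleCat.ofHom_comp, h₁]
      comm₂₃ := by
        simp only [← ModuleCat.ofHom_comp, h₂] }
  have := ShortComplex.ShortExact.extClass_naturality h.shortExact h'.shortExact φ
  rw [Abelian.Ext.comp_assoc_of_third_deg_zero, this]
  rw [Abelian.Ext.comp_assoc_of_second_deg_zero]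

lemma cov_vanish₁ (h : SES f g) (i : ℕ) [Subsingleton (MExt R X D i)]
    [Subsingleton (MExt R X B (i + 1))] : Subsingleton (MExt R X A (i + 1)) :=
  subsingleton_of_forall_eq 0 fun x => by
    obtain ⟨y, rfl⟩ := h.cov_exact₁ (x := x) (Subsingleton.elim _ _)
    rw [Subsingleton.elim y 0, map_zero]

lemma cov_vanish₃ (h : SES f g) (i : ℕ) [Subsingleton (MExt R X B i)]
    [Subsingleton (MExt R X A (i + 1))] : Subsingleton (MExt R X D i) :=
  subsingleton_of_forall_eq 0 fun x => by
    obtain ⟨y, rfl⟩ := h.cov_exact₃ (x := x) (Subsingleton.elim _ _)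
    rw [Subsingleton.elim y 0, map_zero]

lemma con_vanish₁ (h : SES f g) (i : ℕ) [Subsingleton (MExt R B X i)]
    [Subsingleton (MExt R D X (i + 1))] : Subsingleton (MExt R A X i) :=
  subsingleton_of_forall_eq 0 fun x => by
    obtain ⟨y, rfl⟩ := h.con_exact₁ (x := x) (Subsingleton.elim _ _)
    rw [Subsingleton.elim y 0, map_zero]

lemma con_vanish₂ (h : SES f g) (i : ℕ) [Subsingleton (MExt R A X i)]
    [Subsingleton (MExt R D X i)] : Subsingleton (MExt R B X i) :=
  subsingleton_of_forall_eq 0 fun x => by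
    obtain ⟨y, rfl⟩ := h.con_exact₂ (x := x) (Subsingleton.elim _ _)
    rw [Subsingleton.elim y 0, map_zero]

lemma con_vanish₃ (h : SES f g) (i : ℕ) [Subsingleton (MExt R A X i)]
    [Subsingleton (MExt R B X (i + 1))] : Subsingleton (MExt R D X (i + 1)) :=
  subsingleton_of_forall_eq 0 fun x => by
    obtain ⟨y, rfl⟩ := h.con_exact₃ (x := x) (Subsingleton.elim _ _)
    rw [Subsingleton.elim y 0, map_zero]

end SES

section

variable {A B : Type u} [AddCommGroup A] [Module R A] [AddCommGroup B] [Module R B]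

lemma ses_sub (N : Submodule R A) : SES N.subtype N.mkQ :=
  ⟨N.injective_subtype, N.mkQ_surjective, by
    rw [LinearMap.exact_iff]; simp⟩

lemma ses_quot {f : A →ₗ[R] B} (hf : Function.Injective f) :
    SES f (LinearMap.range f).mkQ :=
  ⟨hf, Submodule.mkQ_surjective _, by
    rw [LinearMap.exact_iff]; simp⟩

lemma ses_ker {f : A →ₗ[R] B} (hf : Function.Surjective f) :
    SES (LinearMap.ker f).subtype f :=
  ⟨Submodule.injective_subtype _, hf, by
    rw [LinearMap.exact_iff]; simp⟩

lemma vanish_of_injective {I : Type u} [AddCommGroup I] [Module R I] [Module.Injective R I]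
    (X : Type u) [AddCommGroup X] [Module R X] (i : ℕ) : Subsingleton (MExt R X I (i + 1)) := by
  have : Injective (ModuleCat.of R I) := Module.injective_object_of_injective_module R I
  exact Abelian.Ext.subsingleton_of_injective _ _ _

lemma vanish_of_projective {P : Type u} [AddCommGroup P] [Module R P] [Module.Projective R P]
    (X : Type u) [AddCommGroup X] [Module R X] (i : ℕ) : Subsingleton (MExt R P X (i + 1)) := by
  have : Projective (ModuleCat.of R P) := inferInstance
  exact Abelian.Ext.subsingleton_of_projective _ _ _

lemma injective_of_vanish {I : Type u} [AddCommGroup I] [Module R I]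
    (h : ∀ (X : Type u) [AddCommGroup X] [Module R X], Subsingleton (MExt R X I 1)) :
    Module.Injective R I := by
  have : Injective (ModuleCat.of R I) :=
    injective_iff_subsingleton_ext_one.2 fun {X} => h X
  exact Module.injective_module_of_injective_object R I

end

end

lemma homologyUnop_naturality {ι : Type*} {V : Type*} [Category V] [Abelian V]
    {c : ComplexShape ι} {K L : HomologicalComplex Vᵒᵖ c} (ψ : K ⟶ L) (i : ι) :
    HomologicalComplex.homologyMap ((HomologicalComplex.unopFunctor V c).map ψ.op) i ≫
      (K.homologyUnop i).hom = (L.homologyUnop i).hom ≫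
        (HomologicalComplex.homologyMap ψ i).unop := by
  apply Quiver.Hom.op_inj
  exact (HomologicalComplex.homologyOp_hom_naturality
    ((HomologicalComplex.unopFunctor V c).map ψ.op) i).symm

lemma unop_conj_naturality {V : Type*} [Category V] {HQ HP : V} {KQ KP OQ OP : Vᵒᵖ}
    (uQ : HQ ⟶ KQ.unop) (uP : HP ⟶ KP.unop) (iQ : OQ ≅ KQ) (iP : OP ≅ KP) (h : KP ⟶ KQ)
    (m : HQ ⟶ HP) (e : m ≫ uP = uQ ≫ h.unop) :
    (uQ ≫ iQ.hom.unop) ≫ (iP.hom ≫ h ≫ iQ.inv).unop = m ≫ uP ≫ iP.hom.unop := by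
  rw [reassoc_of% e]
  simp only [unop_comp, Category.assoc]
  have h1 : iQ.hom.unop ≫ iQ.inv.unop = 𝟙 _ := by rw [← unop_comp, iQ.inv_hom_id]; rfl
  rw [reassoc_of% h1]

section

variable {R : Type u} [CommRing R] {X X' : ModuleCat.{u} R}

/-- Functoriality of `ChainComplex.linearYonedaObj`. -/
def yonMap {P Q : ChainComplex (ModuleCat.{u} R) ℕ} (φ : P ⟶ Q) (N : ModuleCat.{u} R) :
    Q.linearYonedaObj R N ⟶ P.linearYonedaObj R N :=
  (HomologicalComplex.unopFunctor _ _).map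
    ((((linearYoneda R (ModuleCat.{u} R)).obj N).rightOp.mapHomologicalComplex _).map φ).op

/-- Cocycles of a projective resolution map onto the derived functor `Ext`. -/
def oldMk (P : ProjectiveResolution X) (n : ℕ) (N : ModuleCat.{u} R) :
    (P.complex.linearYonedaObj R N).cycles n ⟶
      ((Ext R (ModuleCat.{u} R) n).obj (Opposite.op X)).obj N :=
  (P.complex.linearYonedaObj R N).homologyπ n ≫ (P.isoExt n N).inv

lemma oldMk_surjective (P : ProjectiveResolution X) (n : ℕ) (N : ModuleCat.{u} R) :
    Function.Surjective (oldMk P n N) := by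
  rw [← ModuleCat.epi_iff_surjective]
  unfold oldMk
  infer_instance

lemma oldMk_naturality (P : ProjectiveResolution X) (Q : ProjectiveResolution X') (f : X ⟶ X')
    (φ : P.complex ⟶ Q.complex) (w : φ ≫ Q.π = P.π ≫ (ChainComplex.single₀ _).map f)
    (n : ℕ) (N : ModuleCat.{u} R) :
    oldMk Q n N ≫ ((Ext R (ModuleCat.{u} R) n).map f.op).app N =
      HomologicalComplex.cyclesMap (yonMap φ N) n ≫ oldMk P n N := by
  have h1 : ((Ext R (ModuleCat.{u} R) n).map f.op).app N =
      ((((linearYoneda R (ModuleCat.{u} R)).obj N).rightOp.leftDerived n).map f).unop := rfl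
  have h2 := Functor.leftDerived_map_eq ((linearYoneda R (ModuleCat.{u} R)).obj N).rightOp n f φ w
  rw [h1, h2]
  have h3 := homologyUnop_naturality
    ((((linearYoneda R (ModuleCat.{u} R)).obj N).rightOp.mapHomologicalComplex
      (ComplexShape.down ℕ)).map φ) n
  have h5 := unop_conj_naturality
    (HomologicalComplex.homologyUnop _ _).hom (HomologicalComplex.homologyUnop _ _).hom
    (Q.isoLeftDerivedObj ((linearYoneda R (ModuleCat.{u} R)).obj N).rightOp n)
    (P.isoLeftDerivedObj ((linearYoneda R (ModuleCat.{u} R)).obj N).rightOp n) _ _ h3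
  have h6 := congrArg
    (fun t => HomologicalComplex.homologyπ (Q.complex.linearYonedaObj R N) n ≫ t) h5
  refine Eq.trans (Category.assoc _ _ _) (h6.trans ?_)
  exact (HomologicalComplex.homologyπ_naturality_assoc (yonMap φ N) n _)

lemma homologyπ_eq_zero (L : CochainComplex (ModuleCat.{u} R) ℕ) {n i : ℕ}
    (hi : (ComplexShape.up ℕ).prev n = i) (z : L.cycles n) :
    L.homologyπ n z = 0 ↔ ∃ y, L.d i n y = L.iCycles n z := by
  have hex := ShortComplex.exact_of_g_is_cokernel
    (ShortComplex.mk (L.toCycles i n) (L.homologyπ n) (L.toCycles_comp_homologyπ i n))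
    (L.homologyIsCokernel i n hi)
  rw [ShortComplex.ShortExact.moduleCat_exact_iff_function_exact] at hex
  have h2 : Function.Injective (L.iCycles n) := by
    rw [← ModuleCat.mono_iff_injective]; infer_instance
  refine (hex z).trans (exists_congr fun y => ?_)
  rw [← h2.eq_iff]
  have : L.iCycles n (L.toCycles i n y) = L.d i n y := by
    rw [← L.toCycles_i i n]; rfl
  exact Eq.congr_left this

lemma oldMk_eq_zero (P : ProjectiveResolution X) {n : ℕ} {N : ModuleCat.{u} R} {i : ℕ}
    (hi : (ComplexShape.up ℕ).prev n = i) {z : (P.complex.linearYonedaObj R N).cycles n} :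
    oldMk P n N z = 0 ↔ ∃ y, (P.complex.linearYonedaObj R N).d i n y =
      (P.complex.linearYonedaObj R N).iCycles n z := by
  rw [← homologyπ_eq_zero (P.complex.linearYonedaObj R N) hi]
  have : Function.Injective (P.isoExt (R := R) n N).inv := by
    rw [← ModuleCat.mono_iff_injective]; infer_instance
  exact map_eq_zero_iff (P.isoExt (R := R) n N).inv.hom this

lemma d_iCycles (P : ProjectiveResolution X) (n : ℕ) (N : ModuleCat.{u} R)
    (z : (P.complex.linearYonedaObj R N).cycles n) :
    P.complex.d (n + 1) n ≫
      (show P.complex.X n ⟶ N from (P.complex.linearYonedaObj R N).iCycles n z) = 0 := by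
  have := congrArg (fun t => t.hom z)
    ((P.complex.linearYonedaObj R N).iCycles_d n (n + 1))
  exact this

lemma exists_iCycles (P : ProjectiveResolution X) (n : ℕ) (N : ModuleCat.{u} R)
    (f : P.complex.X n ⟶ N) (hf : P.complex.d (n + 1) n ≫ f = 0) :
    ∃ z, (P.complex.linearYonedaObj R N).iCycles n z = f := by
  set L := P.complex.linearYonedaObj R N
  have hex := ShortComplex.exact_of_f_is_kernel
    (ShortComplex.mk (L.iCycles n) (L.d n (n + 1)) (L.iCycles_d n (n + 1)))
    (L.cyclesIsKernel n (n + 1) (by simp))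
  rw [ShortComplex.ShortExact.moduleCat_exact_iff_function_exact] at hex
  exact (hex f).1 hf

/-- Cocycles of a projective resolution map onto `Ext` groups in the derived category. -/
def newMk (P : ProjectiveResolution X) (n : ℕ) (N : ModuleCat.{u} R) :
    (P.complex.linearYonedaObj R N).cycles n →ₗ[R] CategoryTheory.Abelian.Ext.{u} X N n where
  toFun z := P.extMk (show P.complex.X n ⟶ N from (P.complex.linearYonedaObj R N).iCycles n z)
    (n + 1) rfl (d_iCycles P n N z)
  map_add' x y := by
    rw [P.add_extMk]
    congr 1
    exact map_add ((P.complex.linearYonedaObj R N).iCycles n).hom x y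
  map_smul' r x := by
    rw [Abelian.Ext.smul_eq_comp_mk₀, P.extMk_comp_mk₀]
    congr 1
    refine (map_smul ((P.complex.linearYonedaObj R N).iCycles n).hom r x).trans ?_
    simp
    rfl

lemma newMk_surjective (P : ProjectiveResolution X) (n : ℕ) (N : ModuleCat.{u} R) :
    Function.Surjective (newMk P n N) := fun x => by
  obtain ⟨f, hf, rfl⟩ := P.extMk_surjective x (n + 1) rfl
  obtain ⟨z, rfl⟩ := exists_iCycles P n N f hf
  exact ⟨z, rfl⟩

open CochainComplex HomComplex in
lemma extMk_zero_eq_zero (P : ProjectiveResolution X) {N : ModuleCat.{u} R}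
    (f : P.complex.X 0 ⟶ N) (hf : P.complex.d 1 0 ≫ f = 0)
    (h : P.extMk f 1 rfl hf = 0) : f = 0 := by
  simp only [← P.extEquivCohomologyClass.apply_eq_iff_eq,
    ProjectiveResolution.extEquivCohomologyClass_extMk,
    ProjectiveResolution.extEquivCohomologyClass_zero,
    CohomologyClass.mk_eq_zero_iff] at h
  rw [Cocycle.toSingleMk_mem_coboundaries_iff _ _ _ _ _ 1 (by simp)] at h
  obtain ⟨g, hg⟩ := h
  have : g = 0 := (CochainComplex.isZero_of_isStrictlyLE P.cochainComplex 0 1).eq_of_src _ _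
  rw [this, Limits.comp_zero] at hg
  rw [← cancel_epi (P.cochainComplexXIso (-(0 : ℕ)) 0 rfl).hom, ← hg, Limits.comp_zero]

lemma extMk_congr (P : ProjectiveResolution X) {n : ℕ} {N : ModuleCat.{u} R}
    {f g : P.complex.X n ⟶ N} (h : f = g) (m : ℕ) (hm : n + 1 = m)
    (hf : P.complex.d m n ≫ f = 0) (hg : P.complex.d m n ≫ g = 0) :
    P.extMk f m hm hf = P.extMk g m hm hg := by
  subst h; rfl

lemma newMk_eq_zero (P : ProjectiveResolution X) {n : ℕ} {N : ModuleCat.{u} R} {i : ℕ}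
    (hi : (ComplexShape.up ℕ).prev n = i) {z : (P.complex.linearYonedaObj R N).cycles n} :
    newMk P n N z = 0 ↔ ∃ y, (P.complex.linearYonedaObj R N).d i n y =
      (P.complex.linearYonedaObj R N).iCycles n z := by
  cases n with
  | succ n =>
    obtain rfl : n = i := by rw [← hi]; simp
    exact P.extMk_eq_zero_iff _ (n + 2) rfl (d_iCycles P (n + 1) N z) n rfl
  | zero =>
    obtain rfl : 0 = i := by rw [← hi]; simp
    have h1 : newMk P 0 N z = 0 ↔ (show P.complex.X 0 ⟶ N from
        (P.complex.linearYonedaObj R N).iCycles 0 z) = 0 := by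
      constructor
      · exact extMk_zero_eq_zero P _ (d_iCycles P 0 N z)
      · intro h
        exact (extMk_congr P h 1 rfl (d_iCycles P 0 N z) Limits.comp_zero).trans
          (P.extMk_zero 1 rfl)
    rw [h1]
    have h2 : (P.complex.linearYonedaObj R N).d 0 0 = 0 :=
      HomologicalComplex.shape _ _ _ (by simp)
    constructor
    · intro h
      exact ⟨0, (map_zero ((P.complex.linearYonedaObj R N).d 0 0).hom).trans h.symm⟩
    · rintro ⟨y, hy⟩
      refine Eq.trans hy.symm ?_
      rw [h2]
      rfl

lemma newMk_naturality (P : ProjectiveResolution X) (Q : ProjectiveResolution X') (f : X ⟶ X')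
    (φ : P.complex ⟶ Q.complex) (w : φ ≫ Q.π = P.π ≫ (ChainComplex.single₀ _).map f)
    (n : ℕ) (N : ModuleCat.{u} R) (z : (Q.complex.linearYonedaObj R N).cycles n) :
    (Abelian.Ext.mk₀ f).comp (newMk Q n N z) (zero_add n) =
      newMk P n N (HomologicalComplex.cyclesMap (yonMap φ N) n z) := by
  let φ' : P.Hom Q f :=
    { hom := φ
      hom_f_zero_comp_π_f_zero := by
        rw [← HomologicalComplex.comp_f, w, HomologicalComplex.comp_f] }
  refine (ProjectiveResolution.mk₀_comp_extMk _ (n + 1) rfl (d_iCycles Q n N z) φ').trans ?_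
  have h1 : φ.f n ≫ (show Q.complex.X n ⟶ N from (Q.complex.linearYonedaObj R N).iCycles n z) =
      (show P.complex.X n ⟶ N from (P.complex.linearYonedaObj R N).iCycles n
        (HomologicalComplex.cyclesMap (yonMap φ N) n z)) :=
    (congrArg (fun t => t.hom z) (HomologicalComplex.cyclesMap_i (yonMap φ N) n)).symm
  exact extMk_congr P h1 (n + 1) rfl _ (d_iCycles P n N _)

/-- Comparison of `Ext` as derived functor and `Ext` via the derived category. -/
def extCompare (X : ModuleCat.{u} R) (n : ℕ) (N : ModuleCat.{u} R) :
    ((Ext R (ModuleCat.{u} R) n).obj (Opposite.op X)).obj N ≃ₗ[R]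
      CategoryTheory.Abelian.Ext.{u} X N n :=
  let P := projectiveResolution X
  have h : LinearMap.ker (oldMk P n N).hom = LinearMap.ker (newMk P n N) := by
    ext z
    exact (oldMk_eq_zero P rfl).trans (newMk_eq_zero P rfl).symm
  ((oldMk P n N).hom.quotKerEquivOfSurjective (oldMk_surjective P n N)).symm ≪≫ₗ
    Submodule.quotEquivOfEq _ _ h ≪≫ₗ
    (newMk P n N).quotKerEquivOfSurjective (newMk_surjective P n N)

lemma extCompare_oldMk (X : ModuleCat.{u} R) (n : ℕ) (N : ModuleCat.{u} R)
    (z : ((projectiveResolution X).complex.linearYonedaObj R N).cycles n) :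
    extCompare X n N (oldMk (projectiveResolution X) n N z) =
      newMk (projectiveResolution X) n N z := by
  simp only [extCompare, LinearEquiv.trans_apply]
  have : ((oldMk (projectiveResolution X) n N).hom.quotKerEquivOfSurjective
      (oldMk_surjective (projectiveResolution X) n N)).symm
        (oldMk (projectiveResolution X) n N z) = Submodule.Quotient.mk z := by
    rw [LinearEquiv.symm_apply_eq]
    rfl
  rw [this]
  rfl

lemma extCompare_naturality (f : X ⟶ X') (n : ℕ) (N : ModuleCat.{u} R)
    (x : ((Ext R (ModuleCat.{u} R) n).obj (Opposite.op X')).obj N) :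
    extCompare X n N (((Ext R (ModuleCat.{u} R) n).map f.op).app N x) =
      (Abelian.Ext.mk₀ f).comp (extCompare X' n N x) (zero_add n) := by
  obtain ⟨z, rfl⟩ := oldMk_surjective (projectiveResolution X') n N x
  have w := ProjectiveResolution.lift_commutes f (projectiveResolution X)
    (projectiveResolution X')
  have h := congrArg (fun t => t.hom z) (oldMk_naturality _ _ f _ w n N)
  rw [extCompare_oldMk, newMk_naturality _ _ f _ w]
  refine (congrArg (extCompare X n N) h).trans ?_
  exact extCompare_oldMk X n N _

end

section

variable {R : Type u} [CommRing R] (a : Ideal R)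

/-- The projection `R ⧸ a ^ t' → R ⧸ a ^ t`. -/
def powProj {t t' : ℕ} (h : t ≤ t') : (R ⧸ a ^ t') →ₗ[R] (R ⧸ a ^ t) :=
  Submodule.mapQ (a ^ t') (a ^ t) LinearMap.id (Ideal.pow_le_pow_right h)

lemma powProj_mk {t t' : ℕ} (h : t ≤ t') (r : R) :
    powProj a h (Submodule.Quotient.mk r) = Submodule.Quotient.mk r := rfl

lemma powProj_comp {t t' t'' : ℕ} (h : t ≤ t') (h' : t' ≤ t'') :
    powProj a h ∘ₗ powProj a h' = powProj a (h.trans h') := by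
  ext; rfl

/-- `H` is the direct limit of `Ext^i(R ⧸ a ^ t, N)`. -/
def IsLC (i : ℕ) (N H : Type u) [AddCommGroup N] [Module R N] [AddCommGroup H] [Module R H] :
    Prop :=
  ∃ ι : ∀ t : ℕ, MExt R (R ⧸ a ^ t) N i →ₗ[R] H,
    (∀ (t t' : ℕ) (h : t ≤ t') (x : MExt R (R ⧸ a ^ t) N i),
      ι t' (pre N (powProj a h) i x) = ι t x) ∧
    (∀ y, ∃ t x, ι t x = y) ∧
    ∀ t x, ι t x = 0 → ∃ (t' : ℕ) (h : t ≤ t'), pre N (powProj a h) i x = 0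

/-- The direct limit of `Ext^i(R ⧸ a ^ t, N)` vanishes. -/
def IndZero (i : ℕ) (N : Type u) [AddCommGroup N] [Module R N] : Prop :=
  ∀ (t : ℕ) (x : MExt R (R ⧸ a ^ t) N i), ∃ (t' : ℕ) (h : t ≤ t'), pre N (powProj a h) i x = 0

variable {a}

lemma IsLC.indZero {i : ℕ} {N H : Type u} [AddCommGroup N] [Module R N] [AddCommGroup H]
    [Module R H] (h : IsLC a i N H) [Subsingleton H] : IndZero a i N := by
  obtain ⟨ι, -, -, h3⟩ := h
  exact fun t x => h3 t x (Subsingleton.elim _ _)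

open Limits in
theorem isLC_localCohomology (a : Ideal R) (i : ℕ) (N : Type u) [AddCommGroup N] [Module R N] :
    IsLC a i N ((localCohomology a i).obj (ModuleCat.of R N)) := by
  let F := localCohomology.diagram (localCohomology.idealPowersDiagram a) i
  have : HasColimit F := localCohomology.hasColimitDiagram _ _
  let ev := (evaluation (ModuleCat.{u} R) (ModuleCat.{u} R)).obj (ModuleCat.of R N)
  have : PreservesFilteredColimitsOfSize.{0, 0} (forget (ModuleCat.{u} R)) :=
    preservesFilteredColimitsOfSize_shrink.{0, u, 0, u} _
  have hc : IsColimit (ev.mapCocone (colimit.cocone F)) :=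
    isColimitOfPreserves ev (colimit.isColimit F)
  let E (t : ℕ) : (F ⋙ ev).obj (Opposite.op (Opposite.op t)) ≃ₗ[R] MExt R (R ⧸ a ^ t) N i :=
    extCompare (ModuleCat.of R (R ⧸ a ^ t)) i (ModuleCat.of R N)
  let lam (t : ℕ) : (F ⋙ ev).obj (Opposite.op (Opposite.op t)) →ₗ[R]
      ((localCohomology a i).obj (ModuleCat.of R N)) :=
    ((ev.mapCocone (colimit.cocone F)).ι.app (Opposite.op (Opposite.op t))).hom
  have hE : ∀ {t t' : ℕ} (h : t ≤ t') (f : Opposite.op (Opposite.op t) ⟶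
      Opposite.op (Opposite.op t')) (x : (F ⋙ ev).obj (Opposite.op (Opposite.op t))),
      E t' ((F ⋙ ev).map f x) = pre N (powProj a h) i (E t x) := fun {t t'} h f x =>
    extCompare_naturality (ModuleCat.ofHom (powProj a h)) i (ModuleCat.of R N) x
  have hlam : ∀ {t t' : ℕ} (f : Opposite.op (Opposite.op t) ⟶
      Opposite.op (Opposite.op t')) (x : (F ⋙ ev).obj (Opposite.op (Opposite.op t))),
      lam t' ((F ⋙ ev).map f x) = lam t x := fun f x =>
    congrArg (fun k => k.hom x) ((ev.mapCocone (colimit.cocone F)).w f)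
  refine ⟨fun t => lam t ∘ₗ (E t).symm.toLinearMap, ?_, ?_, ?_⟩
  · intro t t' h x
    obtain ⟨y, rfl⟩ := (E t).surjective x
    rw [← hE h (homOfLE h).op.op]
    simp only [LinearMap.comp_apply, LinearEquiv.coe_coe, LinearEquiv.symm_apply_apply]
    exact hlam _ _
  · intro y
    obtain ⟨j, x, hx⟩ := Concrete.isColimit_exists_rep _ hc y
    obtain ⟨⟨t⟩⟩ := j
    refine ⟨t, E t x, ?_⟩
    simp only [LinearMap.comp_apply, LinearEquiv.coe_coe, LinearEquiv.symm_apply_apply]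
    exact hx
  · intro t x hx
    obtain ⟨y, rfl⟩ := (E t).surjective x
    simp only [LinearMap.comp_apply, LinearEquiv.coe_coe, LinearEquiv.symm_apply_apply] at hx
    obtain ⟨⟨⟨t'⟩⟩, f, g, hf⟩ := (Concrete.isColimit_rep_eq_iff_exists (F ⋙ ev)
      (i := Opposite.op (Opposite.op t)) (j := Opposite.op (Opposite.op t)) hc y 0).1
      (hx.trans (map_zero (lam t)).symm)
    have h : t ≤ t' := f.unop.unop.down.down
    refine ⟨t', h, ?_⟩
    rw [← hE h f, hf, map_zero ((F ⋙ ev).map g).hom]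
    exact map_zero (E t')

end

section

variable {R : Type u} [CommRing R] {a : Ideal R}

namespace SES

variable {A B D : Type u} [AddCommGroup A] [Module R A] [AddCommGroup B] [Module R B]
    [AddCommGroup D] [Module R D] {f : A →ₗ[R] B} {g : B →ₗ[R] D}
    {X : Type u} [AddCommGroup X] [Module R X]

lemma comp_zero (h : SES f g) : g ∘ₗ f = 0 := by
  ext x; exact (h.exact (f x)).2 ⟨x, rfl⟩

lemma dCov_post_zero (h : SES f g) (i : ℕ) (x : MExt R X B i) :
    h.dCov X i (post X g i x) = 0 := by
  simp only [post_apply, dCov_apply]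
  rw [Abelian.Ext.comp_assoc_of_second_deg_zero, h.shortExact.comp_extClass,
    Abelian.Ext.comp_zero]

end SES

variable {A B D : Type u} [AddCommGroup A] [Module R A] [AddCommGroup B] [Module R B]
    [AddCommGroup D] [Module R D] {f : A →ₗ[R] B} {g : B →ₗ[R] D}

lemma pre_powProj {t t' t'' : ℕ} (h : t ≤ t') (h' : t' ≤ t'') (i : ℕ)
    (x : MExt R (R ⧸ a ^ t) A i) :
    pre A (powProj a h') i (pre A (powProj a h) i x) = pre A (powProj a (h.trans h')) i x := by
  rw [← pre_comp, powProj_comp]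

lemma indZero_of_subsingleton (i : ℕ) (h : ∀ t, Subsingleton (MExt R (R ⧸ a ^ t) A i)) :
    IndZero a i A := fun t _ => ⟨t, le_rfl, (h t).elim _ _⟩

lemma IndZero.congr (e : A ≃ₗ[R] B) {i : ℕ} (h : IndZero a i A) : IndZero a i B := by
  intro t x
  obtain ⟨y, rfl⟩ := (postEquiv (R ⧸ a ^ t) e i).surjective x
  obtain ⟨t', ht, h0⟩ := h t y
  refine ⟨t', ht, ?_⟩
  have := pre_post (powProj a ht) e.toLinearMap i y
  rw [h0, map_zero] at this
  exact this

lemma IndZero.mid (s : SES f g) {i : ℕ} (hA : IndZero a i A) (hD : IndZero a i D) :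
    IndZero a i B := by
  intro t x
  obtain ⟨t', ht, h0⟩ := hD t (post _ g i x)
  rw [pre_post] at h0
  obtain ⟨y, hy⟩ := s.cov_exact₂ h0
  obtain ⟨t'', ht', h1⟩ := hA t' y
  refine ⟨t'', ht.trans ht', ?_⟩
  rw [← pre_powProj ht ht', ← hy, pre_post, h1, map_zero]

lemma IndZero.right (s : SES f g) {i : ℕ} (hB : IndZero a i B) (hA : IndZero a (i + 1) A) :
    IndZero a i D := by
  intro t x
  obtain ⟨t', ht, h0⟩ := hA t (s.dCov _ i x)
  rw [s.pre_dCov] at h0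
  obtain ⟨y, hy⟩ := s.cov_exact₃ h0
  obtain ⟨t'', ht', h1⟩ := hB t' y
  refine ⟨t'', ht.trans ht', ?_⟩
  rw [← pre_powProj ht ht', ← hy, pre_post, h1, map_zero]

lemma IndZero.left (s : SES f g) {i : ℕ} (hD : IndZero a i D) (hB : IndZero a (i + 1) B) :
    IndZero a (i + 1) A := by
  intro t x
  obtain ⟨t', ht, h0⟩ := hB t (post _ f (i + 1) x)
  rw [pre_post] at h0
  obtain ⟨y, hy⟩ := s.cov_exact₁ h0
  obtain ⟨t'', ht', h1⟩ := hD t' y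
  refine ⟨t'', ht.trans ht', ?_⟩
  rw [← pre_powProj ht ht', ← hy, s.pre_dCov, h1, map_zero]

variable {H : Type u} [AddCommGroup H] [Module R H]

lemma IsLC.congr (e : A ≃ₗ[R] B) {i : ℕ} (h : IsLC a i A H) : IsLC a i B H := by
  obtain ⟨ι, h1, h2, h3⟩ := h
  have key : ∀ {t t' : ℕ} (h : t ≤ t') x, pre B (powProj a h) i (postEquiv (R ⧸ a ^ t) e i x) =
    postEquiv (R ⧸ a ^ t') e i (pre A (powProj a h) i x) := fun h x =>
      pre_post (powProj a h) e.toLinearMap i x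
  refine ⟨fun t => ι t ∘ₗ (postEquiv (R ⧸ a ^ t) e i).symm.toLinearMap, ?_, ?_, ?_⟩
  · intro t t' h x
    obtain ⟨y, rfl⟩ := (postEquiv (R ⧸ a ^ t) e i).surjective x
    rw [key]
    simpa using h1 t t' h y
  · intro y
    obtain ⟨t, x, rfl⟩ := h2 y
    exact ⟨t, postEquiv (R ⧸ a ^ t) e i x, by simp⟩
  · intro t x hx
    obtain ⟨y, rfl⟩ := (postEquiv (R ⧸ a ^ t) e i).surjective x
    obtain ⟨t', h, h0⟩ := h3 t y (by simpa using hx)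
    exact ⟨t', h, by rw [key, h0, map_zero]⟩

lemma IsLC.shift (s : SES f g) {i : ℕ} (h : IsLC a (i + 1) A H) (hB : IndZero a i B)
    (hB' : IndZero a (i + 1) B) : IsLC a i D H := by
  obtain ⟨ι, h1, h2, h3⟩ := h
  refine ⟨fun t => ι t ∘ₗ s.dCov (R ⧸ a ^ t) i, ?_, ?_, ?_⟩
  · intro t t' h x
    simp only [LinearMap.comp_apply]
    rw [← s.pre_dCov, h1]
  · intro y
    obtain ⟨t, x, rfl⟩ := h2 y
    obtain ⟨t', h, h0⟩ := hB' t (post _ f (i + 1) x)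
    rw [pre_post] at h0
    obtain ⟨z, hz⟩ := s.cov_exact₁ h0
    exact ⟨t', z, by rw [LinearMap.comp_apply, hz, h1]⟩
  · intro t x hx
    obtain ⟨t', h, h0⟩ := h3 t _ hx
    rw [s.pre_dCov] at h0
    obtain ⟨z, hz⟩ := s.cov_exact₃ h0
    obtain ⟨t'', h', h0⟩ := hB t' z
    refine ⟨t'', h.trans h', ?_⟩
    rw [← pre_powProj h h', ← hz, pre_post, h0, map_zero]

variable (a) in
/-- The `a`-power torsion submodule. -/
def Gam (M : Type u) [AddCommGroup M] [Module R M] : Submodule R M where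
  carrier := {x | ∃ t : ℕ, ∀ r ∈ a ^ t, r • x = 0}
  add_mem' := by
    rintro x y ⟨t, ht⟩ ⟨t', ht'⟩
    refine ⟨max t t', fun r hr => ?_⟩
    rw [smul_add, ht r (Ideal.pow_le_pow_right (le_max_left _ _) hr),
      ht' r (Ideal.pow_le_pow_right (le_max_right _ _) hr), add_zero]
  zero_mem' := ⟨0, fun r _ => smul_zero r⟩
  smul_mem' := by
    rintro c x ⟨t, ht⟩
    exact ⟨t, fun r hr => by rw [smul_comm, ht r hr, smul_zero]⟩

variable (a) in
/-- The map `R ⧸ a ^ t → M` determined by an element killed by `a ^ t`. -/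
def homOf {M : Type u} [AddCommGroup M] [Module R M] {t : ℕ} (x : M)
    (h : ∀ r ∈ a ^ t, r • x = 0) : (R ⧸ a ^ t) →ₗ[R] M :=
  Submodule.liftQ (a ^ t) (LinearMap.toSpanSingleton R M x) h

@[simp] lemma homOf_mk {M : Type u} [AddCommGroup M] [Module R M] {t : ℕ} (x : M)
    (h : ∀ r ∈ a ^ t, r • x = 0) (r : R) :
    homOf a x h (Submodule.Quotient.mk r) = r • x := rfl

lemma quot_hom_ext {I : Ideal R} {M : Type u} [AddCommGroup M] [Module R M]
    {f g : (R ⧸ I) →ₗ[R] M} (h : f (Submodule.Quotient.mk 1) = g (Submodule.Quotient.mk 1)) :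
    f = g := by
  ext; exact h

lemma killed_by_quot {I : Ideal R} {M : Type u} [AddCommGroup M] [Module R M]
    (f : (R ⧸ I) →ₗ[R] M) (r : R) (hr : r ∈ I) : r • f (Submodule.Quotient.mk 1) = 0 := by
  rw [← map_smul, ← Submodule.Quotient.mk_smul, smul_eq_mul, mul_one,
    (Submodule.Quotient.mk_eq_zero I).2 hr, map_zero]

theorem IsLC.equivGam {M : Type u} [AddCommGroup M] [Module R M] (h : IsLC a 0 M H) :
    Nonempty (H ≃ₗ[R] Gam a M) := by
  obtain ⟨ι, h1, h2, h3⟩ := h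
  let F (x : Gam a M) : H := ι _ ((ext0 _ M).symm (homOf a x.1 x.2.choose_spec))
  have hF' : ∀ (x : M) (t t' : ℕ) (h : t ≤ t') (hx : ∀ r ∈ a ^ t, r • x = 0)
      (hx' : ∀ r ∈ a ^ t', r • x = 0),
      ι t' ((ext0 _ M).symm (homOf a x hx')) = ι t ((ext0 _ M).symm (homOf a x hx)) := by
    intro x t t' h hx hx'
    rw [← h1 t t' h]
    congr 1
    apply (ext0 _ M).injective
    rw [ext0_pre, LinearEquiv.apply_symm_apply, LinearEquiv.apply_symm_apply]
    exact quot_hom_ext rfl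
  have hF : ∀ (x : Gam a M) (t : ℕ) (hx : ∀ r ∈ a ^ t, r • x.1 = 0),
      F x = ι t ((ext0 _ M).symm (homOf a x.1 hx)) := by
    intro x t hx
    rcases le_total x.2.choose t with h | h
    · exact (hF' x.1 _ _ h _ hx).symm
    · exact hF' x.1 _ _ h hx _
  let L : Gam a M →ₗ[R] H :=
    { toFun := F
      map_add' := by
        rintro ⟨x, t, ht⟩ ⟨y, t', ht'⟩
        have k1 : ∀ r ∈ a ^ max t t', r • x = 0 := fun r hr =>
          ht r (Ideal.pow_le_pow_right (le_max_left _ _) hr)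
        have k2 : ∀ r ∈ a ^ max t t', r • y = 0 := fun r hr =>
          ht' r (Ideal.pow_le_pow_right (le_max_right _ _) hr)
        have k3 : ∀ r ∈ a ^ max t t', r • (x + y) = 0 := fun r hr => by
          rw [smul_add, k1 r hr, k2 r hr, add_zero]
        rw [hF ⟨x, t, ht⟩ _ k1, hF ⟨y, t', ht'⟩ _ k2, hF _ _ k3, ← map_add, ← map_add]
        congr 2
        exact quot_hom_ext (smul_add (1 : R) x y)
      map_smul' := by
        rintro c ⟨x, t, ht⟩
        have k3 : ∀ r ∈ a ^ t, r • (c • x) = 0 := fun r hr => by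
          rw [smul_comm, ht r hr, smul_zero]
        rw [hF ⟨x, t, ht⟩ _ ht, hF _ _ k3, RingHom.id_apply, ← map_smul, ← map_smul]
        congr 2
        exact quot_hom_ext (smul_comm (1 : R) c x) }
  refine ⟨(LinearEquiv.ofBijective L ⟨?_, ?_⟩).symm⟩
  · rw [injective_iff_map_eq_zero]
    rintro ⟨x, t, ht⟩ hx
    replace hx : F ⟨x, t, ht⟩ = 0 := hx
    rw [hF _ t ht] at hx
    obtain ⟨t', h, h0⟩ := h3 _ _ hx
    have h0 := congrArg (ext0 _ M) h0
    rw [ext0_pre, LinearEquiv.apply_symm_apply, map_zero] at h0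
    have := LinearMap.congr_fun h0 (Submodule.Quotient.mk 1)
    rw [LinearMap.comp_apply, powProj_mk, homOf_mk, one_smul] at this
    exact Subtype.ext this
  · intro y
    obtain ⟨t, x, rfl⟩ := h2 y
    have hk := killed_by_quot (ext0 _ M x)
    refine ⟨⟨ext0 _ M x (Submodule.Quotient.mk 1), t, hk⟩, (hF _ t hk).trans ?_⟩
    congr 1
    apply (ext0 _ M).injective
    rw [LinearEquiv.apply_symm_apply]
    exact quot_hom_ext ((homOf_mk _ hk 1).trans (one_smul R _))

lemma IndZero.gam_eq_bot {M : Type u} [AddCommGroup M] [Module R M] (h : IndZero a 0 M) :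
    Gam a M = ⊥ := by
  rw [eq_bot_iff]
  rintro x ⟨t, ht⟩
  obtain ⟨t', h, h0⟩ := h t ((ext0 _ M).symm (homOf a x ht))
  have h0 := congrArg (ext0 _ M) h0
  rw [ext0_pre, LinearEquiv.apply_symm_apply, map_zero] at h0
  have := LinearMap.congr_fun h0 (Submodule.Quotient.mk 1)
  rw [LinearMap.comp_apply, powProj_mk, homOf_mk, one_smul] at this
  exact this

end

section

variable {R : Type u} [CommRing R] {a : Ideal R}
variable {A B D : Type u} [AddCommGroup A] [Module R A] [AddCommGroup B] [Module R B]
    [AddCommGroup D] [Module R D] {f : A →ₗ[R] B} {g : B →ₗ[R] D}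

/-- Postcomposition on `Hom`. -/
abbrev homPost (K : Type u) [AddCommGroup K] [Module R K] (g : A →ₗ[R] B) :
    (K →ₗ[R] A) →ₗ[R] (K →ₗ[R] B) := LinearMap.compRight R g

/-- Precomposition on `Hom`. -/
abbrev homPre (Y : Type u) [AddCommGroup Y] [Module R Y] (f : A →ₗ[R] B) :
    (B →ₗ[R] Y) →ₗ[R] (A →ₗ[R] Y) := LinearMap.lcomp R Y f

lemma SES.lift_hom (s : SES f g) {K : Type u} [AddCommGroup K] [Module R K]
    [Subsingleton (MExt R K A 1)] (h : K →ₗ[R] D) : ∃ h' : K →ₗ[R] B, g ∘ₗ h' = h := by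
  obtain ⟨y, hy⟩ := s.cov_exact₃ (x := (ext0 K D).symm h) (Subsingleton.elim _ _)
  refine ⟨ext0 K B y, ?_⟩
  rw [← ext0_post, hy, LinearEquiv.apply_symm_apply]

lemma SES.extend_hom (s : SES f g) {Y : Type u} [AddCommGroup Y] [Module R Y]
    [Subsingleton (MExt R D Y 1)] (h : A →ₗ[R] Y) : ∃ h' : B →ₗ[R] Y, h' ∘ₗ f = h := by
  obtain ⟨y, hy⟩ := s.con_exact₁ (x := (ext0 A Y).symm h) (Subsingleton.elim _ _)
  refine ⟨ext0 B Y y, ?_⟩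
  rw [← ext0_pre, hy, LinearEquiv.apply_symm_apply]

lemma SES.factor (s : SES f g) {K : Type u} [AddCommGroup K] [Module R K] (h : K →ₗ[R] B)
    (hg : g ∘ₗ h = 0) : ∃ h' : K →ₗ[R] A, f ∘ₗ h' = h := by
  have hr : ∀ x, h x ∈ LinearMap.range f := fun x =>
    (s.exact (h x)).1 (LinearMap.congr_fun hg x)
  let e := LinearEquiv.ofInjective f s.inj
  refine ⟨e.symm.toLinearMap ∘ₗ h.codRestrict _ hr, ?_⟩
  ext x
  have : e (e.symm (h.codRestrict _ hr x)) = h.codRestrict _ hr x := e.apply_symm_apply _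
  exact congrArg Subtype.val this

lemma SES.cofactor (s : SES f g) {Y : Type u} [AddCommGroup Y] [Module R Y] (h : B →ₗ[R] Y)
    (hf : h ∘ₗ f = 0) : ∃ h' : D →ₗ[R] Y, h' ∘ₗ g = h := by
  have hk : LinearMap.ker g ≤ LinearMap.ker h := by
    intro x hx
    obtain ⟨y, rfl⟩ := (s.exact x).1 hx
    exact LinearMap.congr_fun hf y
  let e := g.quotKerEquivOfSurjective s.surj
  refine ⟨(LinearMap.ker g).liftQ h hk ∘ₗ e.symm.toLinearMap, ?_⟩
  ext x
  have : e.symm (g x) = Submodule.Quotient.mk x := by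
    rw [LinearEquiv.symm_apply_eq]; rfl
  simp [this]

lemma SES.homPost (s : SES f g) (K : Type u) [AddCommGroup K] [Module R K]
    [Subsingleton (MExt R K A 1)] : SES (homPost K f) (homPost K g) where
  inj h h' e := by
    ext x
    exact s.inj (LinearMap.congr_fun e x)
  surj h := s.lift_hom h
  exact h := by
    constructor
    · exact fun e => s.factor h e
    · rintro ⟨h', rfl⟩
      change g ∘ₗ f ∘ₗ h' = 0
      rw [← LinearMap.comp_assoc, s.comp_zero, LinearMap.zero_comp]

lemma SES.homPre (s : SES f g) (Y : Type u) [AddCommGroup Y] [Module R Y]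
    [Subsingleton (MExt R D Y 1)] : SES (homPre Y g) (homPre Y f) where
  inj h h' e := by
    ext x
    obtain ⟨x, rfl⟩ := s.surj x
    exact LinearMap.congr_fun e x
  surj h := s.extend_hom h
  exact h := by
    constructor
    · exact fun e => s.cofactor h e
    · rintro ⟨h', rfl⟩
      change (h' ∘ₗ g) ∘ₗ f = 0
      rw [LinearMap.comp_assoc, s.comp_zero, LinearMap.comp_zero]

lemma exists_injective_embedding (M : Type u) [AddCommGroup M] [Module R M] :
    ∃ (E : ModuleCat.{u} R) (f : M →ₗ[R] E), Module.Injective R E ∧ Function.Injective f := by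
  obtain ⟨⟨J, hJ, f, hf⟩⟩ := EnoughInjectives.presentation (ModuleCat.of R M)
  exact ⟨J, f.hom, Module.injective_module_of_injective_object R J,
    (ModuleCat.mono_iff_injective f).1 hf⟩

lemma exists_extend_of_ker_le {E : Type u} [AddCommGroup E] [Module R E] [Module.Injective R E]
    (j : A →ₗ[R] B) (f : A →ₗ[R] E) (h : LinearMap.ker j ≤ LinearMap.ker f) :
    ∃ h : B →ₗ[R] E, h ∘ₗ j = f := by
  obtain ⟨k, hk⟩ := Module.Injective.out ((LinearMap.ker j).liftQ j le_rfl)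
    (by rw [← LinearMap.ker_eq_bot]; exact Submodule.ker_liftQ_eq_bot _ _ _ le_rfl)
    ((LinearMap.ker j).liftQ f h)
  refine ⟨k, ?_⟩
  ext x
  exact hk (Submodule.Quotient.mk x)

lemma injective_hom_of_flat {F I : Type u} [AddCommGroup F] [Module R F] [AddCommGroup I]
    [Module R I] [Module.Flat R F] [Module.Injective R I] : Module.Injective R (F →ₗ[R] I) where
  out X Y _ _ _ _ f hf g := by
    obtain ⟨k, hk⟩ := Module.Injective.out (f.rTensor F)
      (Module.Flat.rTensor_preserves_injective_linearMap f hf) (TensorProduct.lift g)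
    refine ⟨TensorProduct.curry k, fun x => ?_⟩
    ext y
    simpa using hk (x ⊗ₜ y)

/-- `M` is `a`-power torsion. -/
def IsTors (a : Ideal R) (M : Type u) [AddCommGroup M] [Module R M] : Prop :=
  ∀ x : M, x ∈ Gam a M

/-- `M` has no `a`-power torsion. -/
def TorsFree (a : Ideal R) (M : Type u) [AddCommGroup M] [Module R M] : Prop :=
  ∀ x : M, x ∈ Gam a M → x = 0

lemma isTors_gam (M : Type u) [AddCommGroup M] [Module R M] : IsTors a (Gam a M) := by
  rintro ⟨x, t, ht⟩
  exact ⟨t, fun r hr => Subtype.ext (ht r hr)⟩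

lemma map_mem_gam (f : A →ₗ[R] B) {x : A} (hx : x ∈ Gam a A) : f x ∈ Gam a B := by
  obtain ⟨t, ht⟩ := hx
  exact ⟨t, fun r hr => by rw [← map_smul, ht r hr, map_zero]⟩

/-- Functoriality of torsion. -/
def gamMap (f : A →ₗ[R] B) : Gam a A →ₗ[R] Gam a B :=
  (f ∘ₗ (Gam a A).subtype).codRestrict _ fun x => map_mem_gam f x.2

lemma isTors_of_killed {T : Type u} [AddCommGroup T] [Module R T]
    (t : ℕ) (h : ∀ r ∈ a ^ t, ∀ x : T, r • x = 0) : IsTors a T := fun x => ⟨t, fun r hr => h r hr x⟩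

lemma isTors_quot (t : ℕ) : IsTors a (R ⧸ a ^ t) := by
  refine isTors_of_killed t fun r hr x => ?_
  obtain ⟨x, rfl⟩ := Submodule.Quotient.mk_surjective _ x
  rw [← Submodule.Quotient.mk_smul, Submodule.Quotient.mk_eq_zero]
  exact Ideal.mul_mem_right _ _ hr

lemma IsTors.quot (h : IsTors a A) {f : A →ₗ[R] B} (hf : Function.Surjective f) :
    IsTors a B := fun x => by
  obtain ⟨y, rfl⟩ := hf x
  exact map_mem_gam f (h y)

lemma TorsFree.subsingleton_hom (h : TorsFree a B) (hA : IsTors a A) :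
    Subsingleton (A →ₗ[R] B) :=
  subsingleton_of_forall_eq 0 fun f => by ext x; exact h _ (map_mem_gam f (hA x))

lemma TorsFree.hom (h : TorsFree a B) (K : Type u) [AddCommGroup K] [Module R K] :
    TorsFree a (K →ₗ[R] B) := by
  rintro f ⟨t, ht⟩
  ext x
  exact h _ ⟨t, fun r hr => LinearMap.congr_fun (ht r hr) x⟩

lemma exists_pow_kill {ι : Type*} (s : Finset ι) {M : Type u} [AddCommGroup M] [Module R M]
    (x : ι → M) (hx : ∀ i, x i ∈ Gam a M) : ∃ t : ℕ, ∀ i ∈ s, ∀ r ∈ a ^ t, r • x i = 0 := by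
  choose t ht using hx
  refine ⟨s.sup t, fun i hi r hr => ht i r (Ideal.pow_le_pow_right (Finset.le_sup hi) hr)⟩

lemma exists_pow_kill_of_finite {M N : Type u} [AddCommGroup M] [Module R M] [AddCommGroup N]
    [Module R N] [Module.Finite R N] (f : N →ₗ[R] M) (hf : ∀ x, f x ∈ Gam a M) :
    ∃ t : ℕ, ∀ r ∈ a ^ t, ∀ x, r • f x = 0 := by
  obtain ⟨S, hS⟩ := Module.Finite.fg_top (R := R) (M := N)
  obtain ⟨t, ht⟩ := exists_pow_kill S f hf
  refine ⟨t, fun r hr x => ?_⟩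
  have : x ∈ Submodule.span R (S : Set N) := hS ▸ Submodule.mem_top
  induction this using Submodule.span_induction with
  | mem x h => exact ht x h r hr
  | zero => simp
  | add x y _ _ hx hy => rw [map_add, smul_add, hx, hy, add_zero]
  | smul c x _ hx => rw [map_smul, smul_comm, hx, smul_zero]

lemma IsTors.hom {K : Type u} [AddCommGroup K] [Module R K] [Module.Finite R K]
    (h : IsTors a B) : IsTors a (K →ₗ[R] B) := fun f => by
  obtain ⟨t, ht⟩ := exists_pow_kill_of_finite f fun x => h (f x)
  exact ⟨t, fun r hr => LinearMap.ext fun x => ht r hr x⟩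

lemma injective_gam [IsNoetherianRing R] {E : Type u} [AddCommGroup E] [Module R E]
    [Module.Injective R E] : Module.Injective R (Gam a E) := by
  refine Module.Baer.injective fun J f => ?_
  obtain ⟨t, ht⟩ := exists_pow_kill_of_finite (a := a) f fun x => isTors_gam E _
  obtain ⟨k, hk⟩ := Ideal.exists_pow_inf_eq_pow_smul a J
  have hk := hk (k + t) (by omega)
  let j : J →ₗ[R] (R ⧸ a ^ (k + t)) := (a ^ (k + t)).mkQ ∘ₗ J.subtype
  have hker : LinearMap.ker j ≤ LinearMap.ker ((Gam a E).subtype ∘ₗ f) := by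
    rintro ⟨x, hxJ⟩ hx
    have hx : x ∈ a ^ (k + t) := (Submodule.Quotient.mk_eq_zero _).1 hx
    have hx2 : x ∈ a ^ (k + t) • (⊤ : Submodule R R) ⊓ J := ⟨by simpa using hx, hxJ⟩
    rw [hk, Nat.add_sub_cancel_left] at hx2
    have hx3 : x ∈ a ^ t • J := Submodule.smul_mono le_rfl inf_le_right hx2
    have key : a ^ t • J ≤ (LinearMap.ker f).map J.subtype := by
      refine Submodule.smul_le.2 fun r hr n hn => ⟨r • ⟨n, hn⟩, ?_, rfl⟩
      exact (map_smul f r _).trans (ht r hr _)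
    obtain ⟨y, hy, rfl⟩ := key hx3
    have : f y = 0 := hy
    simpa using this
  obtain ⟨h, hh⟩ := exists_extend_of_ker_le j _ hker
  refine ⟨LinearMap.toSpanSingleton R _ ⟨h (Submodule.Quotient.mk 1), k + t, killed_by_quot h⟩,
    fun x hx => Subtype.ext ?_⟩
  have h1 := LinearMap.congr_fun hh ⟨x, hx⟩
  refine Eq.trans ?_ h1
  change x • h (Submodule.Quotient.mk 1) = h (Submodule.Quotient.mk x)
  rw [← map_smul, ← Submodule.Quotient.mk_smul, smul_eq_mul, mul_one]

lemma injective_quot_gam [IsNoetherianRing R] {E : Type u} [AddCommGroup E] [Module R E]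
    [Module.Injective R E] : Module.Injective R (E ⧸ Gam a E) := by
  have : Module.Injective R (Gam a E) := injective_gam
  refine injective_of_vanish fun X _ _ => ?_
  have := vanish_of_injective (R := R) (I := Gam a E) X 1
  have := vanish_of_injective (R := R) (I := E) X 0
  exact (ses_sub (Gam a E)).cov_vanish₃ 1

lemma torsFree_quot_gam [IsNoetherianRing R] {M : Type u} [AddCommGroup M] [Module R M] :
    TorsFree a (M ⧸ Gam a M) := by
  rintro x ⟨t, ht⟩
  obtain ⟨x, rfl⟩ := Submodule.Quotient.mk_surjective _ x
  rw [Submodule.Quotient.mk_eq_zero]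
  have h1 : ∀ r : (a ^ t : Ideal R), (LinearMap.toSpanSingleton R M x ∘ₗ (a ^ t).subtype) r ∈
      Gam a M := fun r => by
    have := ht r.1 r.2
    rwa [← Submodule.Quotient.mk_smul, Submodule.Quotient.mk_eq_zero] at this
  obtain ⟨t', ht'⟩ := exists_pow_kill_of_finite _ h1
  refine ⟨t' + t, fun r hr => ?_⟩
  rw [pow_add] at hr
  refine Submodule.mul_induction_on hr (fun m hm n hn => ?_) fun y z hy hz => ?_
  · rw [mul_smul]; exact ht' m hm ⟨n, hn⟩
  · rw [add_smul, hy, hz, add_zero]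

lemma ext_torsFree_injective {I T : Type u} [AddCommGroup I] [Module R I] [Module.Injective R I]
    [AddCommGroup T] [Module R T] (hI : TorsFree a I) (hT : IsTors a T) (i : ℕ) :
    Subsingleton (MExt R T I i) := by
  cases i with
  | zero =>
    have := hI.subsingleton_hom hT
    exact (ext0 T I).toEquiv.subsingleton
  | succ i => exact vanish_of_injective T i

lemma exists_free_cover (K : Type u) [AddCommGroup K] [Module R K] :
    ∃ p : (K →₀ R) →ₗ[R] K, Function.Surjective p :=
  ⟨Finsupp.linearCombination R id, fun x => ⟨Finsupp.single x 1, by simp⟩⟩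

lemma ext_hom_torsFree {I : Type u} [AddCommGroup I] [Module R I] [Module.Injective R I]
    (hI : TorsFree a I) {T : Type u} [AddCommGroup T] [Module R T] (hT : IsTors a T) (i : ℕ) :
    ∀ (K : Type u) [AddCommGroup K] [Module R K], Subsingleton (MExt R T (K →ₗ[R] I) i) := by
  induction i with
  | zero =>
    intro K _ _
    have := (hI.hom K).subsingleton_hom hT
    exact (ext0 T _).toEquiv.subsingleton
  | succ i ih =>
    intro K _ _
    obtain ⟨p, hp⟩ := exists_free_cover (R := R) K
    have := vanish_of_injective (R := R) (I := I) K 0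
    have s := (ses_ker hp).homPre I
    have := ih (LinearMap.ker p)
    have : Module.Injective R ((K →₀ R) →ₗ[R] I) := injective_hom_of_flat
    have := vanish_of_injective (R := R) (I := ((K →₀ R) →ₗ[R] I)) T i
    exact s.cov_vanish₁ i

lemma indZero_hom_torsFree {I : Type u} [AddCommGroup I] [Module R I] [Module.Injective R I]
    (hI : TorsFree a I) (i : ℕ) (K : Type u) [AddCommGroup K] [Module R K] :
    IndZero a i (K →ₗ[R] I) :=
  indZero_of_subsingleton i fun t => ext_hom_torsFree hI (isTors_quot t) i K

lemma exists_torsion_embedding [IsNoetherianRing R] {T : Type u} [AddCommGroup T] [Module R T]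
    (hT : IsTors a T) : ∃ (E : ModuleCat.{u} R) (f : T →ₗ[R] E), Module.Injective R E ∧
      IsTors a E ∧ Function.Injective f := by
  obtain ⟨E, f, hE, hf⟩ := exists_injective_embedding (R := R) T
  exact ⟨ModuleCat.of R (Gam a E), f.codRestrict _ fun x => map_mem_gam f (hT x), injective_gam,
    isTors_gam E, fun x y h => hf (congrArg Subtype.val h)⟩

lemma exists_torsFree_embedding [IsNoetherianRing R] {N : Type u} [AddCommGroup N] [Module R N]
    (hN : TorsFree a N) : ∃ (E : ModuleCat.{u} R) (f : N →ₗ[R] E), Module.Injective R E ∧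
      TorsFree a E ∧ Function.Injective f := by
  obtain ⟨E, f, hE, hf⟩ := exists_injective_embedding (R := R) N
  refine ⟨ModuleCat.of R (E ⧸ Gam a E), (Gam a E).mkQ ∘ₗ f, injective_quot_gam,
    torsFree_quot_gam, ?_⟩
  rw [injective_iff_map_eq_zero]
  intro x hx
  obtain ⟨t, ht⟩ := (Submodule.Quotient.mk_eq_zero _).1 hx
  exact hN x ⟨t, fun r hr => hf (by rw [map_smul, ht r hr, map_zero])⟩

lemma indZero_tors [IsNoetherianRing R] (i : ℕ) :
    ∀ (T : Type u) [AddCommGroup T] [Module R T], IsTors a T → IndZero a (i + 1) T := by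
  induction i with
  | zero =>
    intro T _ _ hT
    obtain ⟨E, f, hE, hE', hf⟩ := exists_torsion_embedding hT
    have s := ses_quot hf
    intro t x
    have := vanish_of_injective (R := R) (I := E) (R ⧸ a ^ t) 0
    obtain ⟨y, rfl⟩ := s.cov_exact₁ (x := x) (Subsingleton.elim _ _)
    obtain ⟨h, rfl⟩ := (ext0 _ _).symm.surjective y
    obtain ⟨e, he⟩ := s.surj (h (Submodule.Quotient.mk 1))
    obtain ⟨t', ht'⟩ := hE' e
    have hk : ∀ r ∈ a ^ max t t', r • e = 0 := fun r hr =>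
      ht' r (Ideal.pow_le_pow_right (le_max_right _ _) hr)
    refine ⟨max t t', le_max_left _ _, ?_⟩
    rw [s.pre_dCov]
    have : pre _ (powProj a (le_max_left t t')) 0 ((ext0 _ _).symm h) =
        post _ (LinearMap.range f).mkQ 0 ((ext0 _ _).symm (homOf a e hk)) := by
      apply (ext0 _ _).injective
      rw [ext0_pre, ext0_post, LinearEquiv.apply_symm_apply, LinearEquiv.apply_symm_apply]
      refine quot_hom_ext (he.symm.trans ?_)
      change _ = (LinearMap.range f).mkQ ((1 : R) • e)
      rw [one_smul]
    rw [this, s.dCov_post_zero]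
  | succ i ih =>
    intro T _ _ hT
    obtain ⟨E, f, hE, hE', hf⟩ := exists_torsion_embedding hT
    refine IndZero.left (ses_quot hf) (ih _ (hE'.quot (Submodule.mkQ_surjective _))) ?_
    exact indZero_of_subsingleton _ fun t => vanish_of_injective _ _

lemma indZero_hom_injective [IsNoetherianRing R] {E K : Type u} [AddCommGroup E] [Module R E]
    [Module.Injective R E] [AddCommGroup K] [Module R K] [Module.Finite R K] (i : ℕ) :
    IndZero a (i + 1) (K →ₗ[R] E) := by
  have : Module.Injective R (Gam a E) := injective_gam
  have : Module.Injective R (E ⧸ Gam a E) := injective_quot_gam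
  have := vanish_of_injective (R := R) (I := Gam a E) K 0
  exact IndZero.mid ((ses_sub (Gam a E)).homPost K) (indZero_tors i _ (isTors_gam E).hom)
    (indZero_hom_torsFree torsFree_quot_gam _ K)

end

section

variable {R : Type u} [CommRing R]
variable (R) (C : Type u) [AddCommGroup C] [Module R C]

/-- Semidualizing modules, in terms of `MExt`. -/
structure SemiDual : Prop where
  finite : Module.Finite R C
  bij : Function.Bijective (LinearMap.lsmul R C)
  ext : ∀ i, Subsingleton (MExt R C C (i + 1))

/-- `Ext^i(-, W)` vanishes in all degrees above `e`. -/
def FinId (e : ℕ) (W : Type u) [AddCommGroup W] [Module R W] : Prop :=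
  ∀ (X : Type u) [AddCommGroup X] [Module R X] (i : ℕ), e < i → Subsingleton (MExt R X W i)

/-- `Ext^i(X, Y) = 0` for all positive `i`. -/
def ExtPerp (X Y : Type u) [AddCommGroup X] [Module R X]
    [AddCommGroup Y] [Module R Y] : Prop :=
  ∀ i : ℕ, Subsingleton (MExt R X Y (i + 1))

variable {R C}
variable {W : Type u} [AddCommGroup W] [Module R W]

lemma FinId.mono {e e' : ℕ} (h : FinId R e W) (he : e ≤ e') : FinId R e' W :=
  fun X _ _ i hi => h X i (by omega)

lemma finId_zero_iff : FinId R 0 W ↔ Module.Injective R W := by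
  constructor
  · exact fun h => injective_of_vanish fun X _ _ => h X 1 one_pos
  · intro h X _ _ i hi
    obtain ⟨i, rfl⟩ := Nat.exists_eq_succ_of_ne_zero hi.ne'
    exact vanish_of_injective X i

lemma extPerp_injective (X I : Type u) [AddCommGroup X] [Module R X] [AddCommGroup I]
    [Module R I] [Module.Injective R I] : ExtPerp R X I := fun i => vanish_of_injective X i

lemma ext_subsingleton_left (X Y : Type u) [AddCommGroup X] [Module R X]
    [AddCommGroup Y] [Module R Y] [Subsingleton X] (i : ℕ) : Subsingleton (MExt R X Y i) :=
  subsingleton_of_forall_eq 0 fun x => by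
    rw [← pre_id i x, Subsingleton.elim (LinearMap.id : X →ₗ[R] X) 0, pre_zero]

lemma ext_subsingleton_right (X Y : Type u) [AddCommGroup X] [Module R X]
    [AddCommGroup Y] [Module R Y] [Subsingleton Y] (i : ℕ) : Subsingleton (MExt R X Y i) :=
  subsingleton_of_forall_eq 0 fun x => by
    rw [← post_id i x, Subsingleton.elim (LinearMap.id : Y →ₗ[R] Y) 0, post_zero]

lemma ses_prod (A B : Type u) [AddCommGroup A] [Module R A] [AddCommGroup B] [Module R B] :
    SES (LinearMap.inl R A B) (LinearMap.snd R A B) where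
  inj := LinearMap.inl_injective
  surj := LinearMap.snd_surjective
  exact := Function.Exact.inl_snd

lemma ExtPerp.pi {X Y : Type u} [AddCommGroup X] [Module R X]
    [AddCommGroup Y] [Module R Y] (h : ExtPerp R X Y) (n : ℕ) : ExtPerp R (Fin n → X) Y := by
  induction n with
  | zero => exact fun i => ext_subsingleton_left _ _ _
  | succ n ih =>
    intro i
    have := h i
    have := ih i
    have h3 := (ses_prod (R := R) X (Fin n → X)).con_vanish₂ (X := Y) (i + 1)
    exact (preEquiv Y (Fin.consLinearEquiv R fun _ : Fin (n + 1) => X) (i + 1)).toEquiv.subsingleton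

lemma ExtPerp.homFree {C W : Type u} [AddCommGroup C] [Module R C]
    [AddCommGroup W] [Module R W] (h : ExtPerp R C W) (n : ℕ) :
    ExtPerp R ((Fin n → R) →ₗ[R] C) W := fun i =>
  have := h.pi n i
  (preEquiv W ((Pi.basisFun R (Fin n)).constr R) (i + 1)).toEquiv.subsingleton

lemma ExtPerp.ker {n : ℕ} {K C : Type u} [AddCommGroup K] [Module R K] [AddCommGroup C]
    [Module R C] (h : ExtPerp R K C) {p : (Fin n → R) →ₗ[R] K} (hp : Function.Surjective p) :
    ExtPerp R (LinearMap.ker p) C := fun i => by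
  have := vanish_of_projective (R := R) (P := Fin n → R) C i
  have := h (i + 1)
  exact (ses_ker hp).con_vanish₁ (i + 1)

lemma extPerp_hom [IsNoetherianRing R] {e : ℕ} (hW : FinId R e W) (hCW : ExtPerp R C W)
    (K : Type u) [AddCommGroup K] [Module R K] [Module.Finite R K] (hK : ExtPerp R K C) :
    ExtPerp R (K →ₗ[R] C) W := by
  have main : ∀ (j : ℕ) (K : Type u) [AddCommGroup K] [Module R K] [Module.Finite R K]
      (_ : ExtPerp R K C) (i : ℕ), e < i + 1 + j →
      Subsingleton (MExt R (K →ₗ[R] C) W (i + 1)) := by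
    intro j
    induction j with
    | zero => exact fun K _ _ _ _ i hi => hW _ _ hi
    | succ j ih =>
      intro K _ _ _ hK i hi
      obtain ⟨n, p, hp⟩ := Module.Finite.exists_fin' R K
      have := hK 0
      have s := (ses_ker hp).homPre C
      have := ih (LinearMap.ker p) (hK.ker hp) (i + 1) (by omega)
      have := hCW.homFree n i
      exact s.con_vanish₁ (i + 1)
  exact fun i => main e K hK i (by omega)

/-- The evaluation map `K ⊗ Hom(C, W) → Hom(Hom(K, C), W)`. -/
def evT (R : Type u) [CommRing R] (K C W : Type u) [AddCommGroup K] [Module R K] [AddCommGroup C] [Module R C]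
    [AddCommGroup W] [Module R W] : K ⊗[R] (C →ₗ[R] W) →ₗ[R] ((K →ₗ[R] C) →ₗ[R] W) :=
  TensorProduct.lift (LinearMap.mk₂ R (fun k φ => φ ∘ₗ LinearMap.applyₗ k)
    (fun k k' φ => by ext; simp) (fun r k φ => by ext; simp) (fun k φ φ' => by ext; simp)
    (fun r k φ => by ext; simp))

@[simp] lemma evT_tmul {K C W : Type u} [AddCommGroup K] [Module R K] [AddCommGroup C]
    [Module R C] [AddCommGroup W] [Module R W] (k : K) (φ : C →ₗ[R] W) (h : K →ₗ[R] C) :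
    evT R K C W (k ⊗ₜ φ) h = φ (h k) := rfl

lemma evT_naturality {K K' : Type u} [AddCommGroup K] [Module R K] [AddCommGroup K']
    [Module R K'] (p : K →ₗ[R] K') (z : K ⊗[R] (C →ₗ[R] W)) :
    evT R K' C W (p.rTensor _ z) = evT R K C W z ∘ₗ homPre C p := by
  have : evT R K' C W ∘ₗ p.rTensor _ = homPre W (homPre C p) ∘ₗ evT R K C W := by
    ext; rfl
  exact LinearMap.congr_fun this z

lemma evT_free (C W : Type u) [AddCommGroup C] [Module R C] [AddCommGroup W] [Module R W]
    (n : ℕ) : Function.Bijective (evT R (Fin n → R) C W) := by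
  let G (h : ((Fin n → R) →ₗ[R] C) →ₗ[R] W) : (Fin n → R) ⊗[R] (C →ₗ[R] W) :=
    ∑ i, (Pi.single i 1 : Fin n → R) ⊗ₜ (h ∘ₗ LinearMap.smulRightₗ (LinearMap.proj i))
  have hG : ∀ z, G (evT R _ C W z) = z := by
    intro z
    induction z using TensorProduct.induction_on with
    | zero => simp [G]
    | tmul x φ =>
      have : ∀ i, (evT R (Fin n → R) C W (x ⊗ₜ[R] φ)) ∘ₗ LinearMap.smulRightₗ (LinearMap.proj i) =
          x i • φ := by
        intro i; ext c; simp
      simp only [G, this, ← TensorProduct.smul_tmul, ← TensorProduct.sum_tmul]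
      congr 1
      ext j
      simp [Pi.single_apply]
    | add x y hx hy =>
      have : G (evT R _ C W (x + y)) = G (evT R _ C W x) + G (evT R _ C W y) := by
        simp [G, LinearMap.add_comp, TensorProduct.tmul_add, Finset.sum_add_distrib]
      rw [this, hx, hy]
  refine ⟨Function.LeftInverse.injective hG, fun h => ⟨G h, ?_⟩⟩
  ext g
  simp only [G, map_sum, LinearMap.sum_apply, evT_tmul, LinearMap.comp_apply]
  rw [← map_sum]
  congr 1
  ext i
  simp [Pi.single_apply]

lemma evT_surjective [IsNoetherianRing R] {e : ℕ} (hW : FinId R e W) (hCW : ExtPerp R C W)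
    (K : Type u) [AddCommGroup K] [Module R K] [Module.Finite R K] (hK : ExtPerp R K C) :
    Function.Surjective (evT R K C W) := by
  obtain ⟨n, p, hp⟩ := Module.Finite.exists_fin' R K
  have := hK 0
  have s := (ses_ker hp).homPre C
  intro h
  have := extPerp_hom hW hCW _ (hK.ker hp) 0
  obtain ⟨h', rfl⟩ := s.extend_hom h
  obtain ⟨z, rfl⟩ := (evT_free C W n).2 h'
  exact ⟨p.rTensor _ z, evT_naturality p z⟩

lemma evT_bijective [IsNoetherianRing R] {e : ℕ} (hW : FinId R e W) (hCW : ExtPerp R C W)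
    (K : Type u) [AddCommGroup K] [Module R K] [Module.Finite R K] (hK : ExtPerp R K C) :
    Function.Bijective (evT R K C W) := by
  refine ⟨?_, evT_surjective hW hCW K hK⟩
  obtain ⟨n, p, hp⟩ := Module.Finite.exists_fin' R K
  have := hK 0
  have s := (ses_ker hp).homPre C
  rw [injective_iff_map_eq_zero]
  intro y hy
  obtain ⟨z, rfl⟩ := LinearMap.rTensor_surjective (C →ₗ[R] W) hp y
  rw [evT_naturality] at hy
  obtain ⟨h', hh'⟩ := s.cofactor _ hy
  obtain ⟨w, rfl⟩ := evT_surjective hW hCW _ (hK.ker hp) h'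
  rw [← evT_naturality] at hh'
  rw [← (evT_free C W n).1 hh', ← LinearMap.comp_apply, ← LinearMap.rTensor_comp,
    (ses_ker hp).comp_zero, LinearMap.rTensor_zero, LinearMap.zero_apply]

/-- The evaluation map `C ⊗ Hom(C, W) → W`. -/
def evE (R : Type u) [CommRing R] (C W : Type u) [AddCommGroup C] [Module R C]
    [AddCommGroup W] [Module R W] : C ⊗[R] (C →ₗ[R] W) →ₗ[R] W :=
  LinearMap.applyₗ (LinearMap.id : C →ₗ[R] C) ∘ₗ evT R C C W

@[simp] lemma evE_tmul (c : C) (φ : C →ₗ[R] W) : evE R C W (c ⊗ₜ φ) = φ c := rfl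

lemma evE_bijective [IsNoetherianRing R] (hC : SemiDual R C) {e : ℕ} (hW : FinId R e W)
    (hCW : ExtPerp R C W) : Function.Bijective (evE R C W) := by
  have := hC.finite
  have hb := evT_bijective hW hCW C hC.ext
  let L : R ≃ₗ[R] (C →ₗ[R] C) := LinearEquiv.ofBijective _ hC.bij
  have hL : ∀ r, L r = r • LinearMap.id := fun r => rfl
  constructor
  · rw [injective_iff_map_eq_zero]
    intro z hz
    refine (injective_iff_map_eq_zero _).1 hb.1 z ?_
    ext h
    obtain ⟨r, rfl⟩ := L.surjective h
    rw [hL, map_smul]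
    replace hz : evT R C C W z LinearMap.id = 0 := hz
    simp [hz]
  · intro w
    obtain ⟨z, hz⟩ := hb.2 (LinearMap.toSpanSingleton R W w ∘ₗ L.symm.toLinearMap)
    refine ⟨z, ?_⟩
    change evT R C C W z LinearMap.id = w
    have : L.symm LinearMap.id = 1 := by
      rw [LinearEquiv.symm_apply_eq, hL, one_smul]
    rw [hz]
    simp [this]

lemma mem_of_forall_hom [IsNoetherianRing R] (hC : SemiDual R C) {e : ℕ} (hW : FinId R e W)
    (hCW : ExtPerp R C W) (S : Submodule R W) (h : ∀ (φ : C →ₗ[R] W) (c : C), φ c ∈ S) (w : W) :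
    w ∈ S := by
  obtain ⟨z, rfl⟩ := (evE_bijective hC hW hCW).2 w
  induction z using TensorProduct.induction_on with
  | zero => simp
  | tmul c φ => exact h φ c
  | add x y hx hy => rw [map_add]; exact S.add_mem hx hy

lemma exists_hom_of_hom [IsNoetherianRing R] (hC : SemiDual R C) {e : ℕ} (hW : FinId R e W)
    (hCW : ExtPerp R C W) {V : Type u} [AddCommGroup V] [Module R V]
    (θ : (C →ₗ[R] W) →ₗ[R] (C →ₗ[R] V)) : ∃ α : W →ₗ[R] V, θ = homPost C α := by
  let E := LinearEquiv.ofBijective _ (evE_bijective hC hW hCW)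
  refine ⟨evE R C V ∘ₗ θ.lTensor C ∘ₗ E.symm.toLinearMap, ?_⟩
  ext φ c
  have : E.symm (φ c) = c ⊗ₜ φ := by
    rw [LinearEquiv.symm_apply_eq]; rfl
  simp [this]

lemma ext_hom_hom [IsNoetherianRing R] {E I : Type u} [AddCommGroup E] [Module R E]
    [Module.Injective R E] [AddCommGroup I] [Module R I] [Module.Injective R I] (i : ℕ) :
    ∀ (K : Type u) [AddCommGroup K] [Module R K] [Module.Finite R K] (_ : ExtPerp R K C),
      Subsingleton (MExt R (C →ₗ[R] E) (K →ₗ[R] I) (i + 1)) := by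
  induction i with
  | zero =>
    intro K _ _ _ hK
    obtain ⟨n, p, hp⟩ := Module.Finite.exists_fin' R K
    have := hK 0
    have sC := (ses_ker hp).homPre C
    have := vanish_of_injective (R := R) (I := I) K 0
    have s := (ses_ker hp).homPre I
    have hE : FinId R 0 E := finId_zero_iff.2 inferInstance
    have hK1 := evT_bijective hE (extPerp_injective C E) _ (hK.ker hp)
    have hinj : Function.Injective
        ((LinearMap.ker p).subtype.rTensor (C →ₗ[R] E)) := by
      rw [injective_iff_map_eq_zero]
      intro z hz
      refine (injective_iff_map_eq_zero _).1 hK1.1 z ?_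
      have := congrArg (evT R _ C E) hz
      rw [evT_naturality, map_zero] at this
      ext h
      obtain ⟨h, rfl⟩ := sC.surj h
      exact LinearMap.congr_fun this h
    have : Module.Injective R ((Fin n → R) →ₗ[R] I) := injective_hom_of_flat
    have := vanish_of_injective (R := R) (I := ((Fin n → R) →ₗ[R] I)) (C →ₗ[R] E) 0
    refine subsingleton_of_forall_eq 0 fun x => ?_
    obtain ⟨y, rfl⟩ := s.cov_exact₁ (x := x) (Subsingleton.elim _ _)
    obtain ⟨θ, rfl⟩ := (ext0 _ _).symm.surjective y
    obtain ⟨k, hk⟩ := Module.Injective.out (R := R)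
      (X := LinearMap.ker p ⊗[R] (C →ₗ[R] E)) (Y := (Fin n → R) ⊗[R] (C →ₗ[R] E)) _ hinj (TensorProduct.lift θ.flip)
    have : (ext0 _ _).symm θ =
        post _ (homPre I (LinearMap.ker p).subtype) 0 ((ext0 _ _).symm (curry k).flip) := by
      apply (ext0 _ _).injective
      rw [ext0_post, LinearEquiv.apply_symm_apply, LinearEquiv.apply_symm_apply]
      ext φ c
      simpa using (hk (c ⊗ₜ φ)).symm
    rw [this, s.dCov_post_zero]
  | succ i ih =>
    intro K _ _ _ hK
    obtain ⟨n, p, hp⟩ := Module.Finite.exists_fin' R K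
    have := vanish_of_injective (R := R) (I := I) K 0
    have s := (ses_ker hp).homPre I
    have := ih _ (hK.ker hp)
    have : Module.Injective R ((Fin n → R) →ₗ[R] I) := injective_hom_of_flat
    have := vanish_of_injective (R := R) (I := ((Fin n → R) →ₗ[R] I)) (C →ₗ[R] E) (i + 1)
    exact s.cov_vanish₁ (i + 1)

end

section

variable {R : Type u} [CommRing R] {a : Ideal R}
variable {C : Type u} [AddCommGroup C] [Module R C]

lemma post_gam_surjective_zero {T N : Type u} [AddCommGroup T] [Module R T]
    [AddCommGroup N] [Module R N] (hT : IsTors a T) :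
    Function.Surjective (post T (Gam a N).subtype 0) := fun y => by
  refine ⟨(ext0 _ _).symm ((ext0 _ _ y).codRestrict _ fun x => map_mem_gam _ (hT x)), ?_⟩
  apply (ext0 _ _).injective
  rw [ext0_post, LinearEquiv.apply_symm_apply]
  rfl

lemma lift_gam_hom [IsNoetherianRing R] [Module.Finite R C] {A B D : Type u}
    [AddCommGroup A] [Module R A] [AddCommGroup B] [Module R B] [AddCommGroup D] [Module R D]
    {f : A →ₗ[R] B} {g : B →ₗ[R] D} (s : SES f g) [Subsingleton (MExt R C A 1)]
    (h : IndZero a 1 (C →ₗ[R] A)) (φ : C →ₗ[R] Gam a D) :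
    ∃ ψ : C →ₗ[R] Gam a B, gamMap g ∘ₗ ψ = φ := by
  have hs := s.homPost C
  obtain ⟨t, ht⟩ := (isTors_gam (a := a) D).hom φ
  have ht' : ∀ r ∈ a ^ t, r • ((Gam a D).subtype ∘ₗ φ) = 0 := fun r hr => by
    rw [← LinearMap.comp_smul, ht r hr, LinearMap.comp_zero]
  obtain ⟨t', htt, h0⟩ := h t (hs.dCov _ 0 ((ext0 _ _).symm (homOf a _ ht')))
  rw [hs.pre_dCov] at h0
  obtain ⟨y, hy⟩ := hs.cov_exact₃ h0
  replace hy := congrArg (ext0 _ _) hy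
  rw [ext0_post, ext0_pre, LinearEquiv.apply_symm_apply] at hy
  have h1 := LinearMap.congr_fun hy (Submodule.Quotient.mk 1)
  replace h1 : g ∘ₗ (ext0 _ _ y (Submodule.Quotient.mk 1)) = (1 : R) • ((Gam a D).subtype ∘ₗ φ) := h1
  rw [one_smul] at h1
  refine ⟨(ext0 _ _ y (Submodule.Quotient.mk 1)).codRestrict _ fun c => ⟨t', fun r hr =>
    LinearMap.congr_fun (killed_by_quot (ext0 _ _ y) r hr) c⟩, ?_⟩
  ext c
  exact LinearMap.congr_fun h1 c

lemma ses_gam {A B D : Type u}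
    [AddCommGroup A] [Module R A] [AddCommGroup B] [Module R B] [AddCommGroup D] [Module R D]
    {f : A →ₗ[R] B} {g : B →ₗ[R] D} (s : SES f g) (h : Function.Surjective (gamMap (a := a) g)) :
    SES (gamMap (a := a) f) (gamMap (a := a) g) where
  inj x y e := Subtype.ext (s.inj (congrArg Subtype.val e))
  surj := h
  exact x := by
    constructor
    · intro hx
      obtain ⟨z, hz⟩ := (s.exact x.1).1 (congrArg Subtype.val hx)
      obtain ⟨t, ht⟩ := x.2
      refine ⟨⟨z, t, fun r hr => s.inj ?_⟩, Subtype.ext hz⟩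
      rw [map_smul, hz, ht r hr, map_zero]
    · rintro ⟨z, rfl⟩
      exact Subtype.ext ((s.exact _).2 ⟨z.1, rfl⟩)

theorem gam_finId [IsNoetherianRing R] (hC : SemiDual R C) (e : ℕ) :
    ∀ (N : Type u) [AddCommGroup N] [Module R N], FinId R e N → ExtPerp R C N →
      (∀ i, IndZero a (i + 1) (C →ₗ[R] N)) →
      FinId R e (Gam a N) ∧ ExtPerp R C (Gam a N) ∧
        ∀ (T : Type u) [AddCommGroup T] [Module R T], IsTors a T → ∀ i,
          Function.Surjective (post T (Gam a N).subtype i) := by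
  have := hC.finite
  induction e with
  | zero =>
    intro N _ _ hN _ _
    have := finId_zero_iff.1 hN
    have : Module.Injective R (Gam a N) := injective_gam
    refine ⟨finId_zero_iff.2 this, extPerp_injective C _, fun T _ _ hT i => ?_⟩
    cases i with
    | zero => exact post_gam_surjective_zero hT
    | succ i =>
      have := vanish_of_injective (R := R) (I := N) T i
      exact fun y => ⟨0, Subsingleton.elim _ _⟩
  | succ e ih =>
    intro N _ _ hN hCN hI
    obtain ⟨E, f, hE, hf⟩ := exists_injective_embedding (R := R) N
    have s := ses_quot hf
    have hCN0 := hCN 0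
    have : Module.Injective R (Gam a E) := injective_gam
    have hEv := fun (X : Type u) [AddCommGroup X] [Module R X] =>
      vanish_of_injective (R := R) (I := E) X
    have hΓEv := fun (X : Type u) [AddCommGroup X] [Module R X] =>
      vanish_of_injective (R := R) (I := Gam a E) X
    obtain ⟨F, P, S⟩ := ih (E ⧸ LinearMap.range f)
      (fun X _ _ i hi => by
        obtain ⟨i, rfl⟩ := Nat.exists_eq_succ_of_ne_zero (by omega : i ≠ 0)
        have := hN X (i + 2) (by omega)
        have := hEv X i
        exact s.cov_vanish₃ (i + 1))
      (fun i => by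
        have := hCN (i + 1)
        have := hEv C i
        exact s.cov_vanish₃ (i + 1))
      (fun i => (indZero_hom_injective i).right (s.homPost C) (hI (i + 1)))
    have hlift := fun φ => lift_gam_hom (C := C) s (hI 0) φ
    have hsurj : Function.Surjective (gamMap (a := a) (LinearMap.range f).mkQ) := fun w => by
      refine mem_of_forall_hom hC F P (LinearMap.range _) (fun φ c => ?_) w
      obtain ⟨ψ, rfl⟩ := hlift φ
      exact ⟨ψ c, rfl⟩
    have sΓ := ses_gam s hsurj
    refine ⟨fun X _ _ i hi => ?_, fun i => ?_, fun T _ _ hT i => ?_⟩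
    · obtain ⟨i, rfl⟩ := Nat.exists_eq_succ_of_ne_zero (by omega : i ≠ 0)
      have := F X i (by omega)
      have := hΓEv X i
      exact sΓ.cov_vanish₁ i
    · cases i with
      | zero =>
        refine subsingleton_of_forall_eq 0 fun x => ?_
        have := hΓEv C 0
        obtain ⟨y, rfl⟩ := sΓ.cov_exact₁ (x := x) (Subsingleton.elim _ _)
        obtain ⟨ψ, hψ⟩ := hlift (ext0 _ _ y)
        have : y = post C (gamMap (LinearMap.range f).mkQ) 0 ((ext0 _ _).symm ψ) := by
          apply (ext0 _ _).injective
          rw [ext0_post, LinearEquiv.apply_symm_apply, hψ]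
        rw [this, sΓ.dCov_post_zero]
      | succ i =>
        have := P i
        have := hΓEv C (i + 1)
        exact sΓ.cov_vanish₁ (i + 1)
    · cases i with
      | zero => exact post_gam_surjective_zero hT
      | succ i =>
        intro y
        have := hEv T i
        obtain ⟨z, rfl⟩ := s.cov_exact₁ (x := y) (Subsingleton.elim _ _)
        obtain ⟨z, rfl⟩ := S T hT i z
        exact ⟨_, sΓ.dCov_post s _ (Gam a E).subtype _ rfl rfl i z⟩

end

section

variable {R : Type u} [CommRing R] {a : Ideal R}
variable {C : Type u} [AddCommGroup C] [Module R C]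

lemma SemiDual.annihilator (hC : SemiDual R C) : Module.annihilator R C = ⊥ := by
  rw [eq_bot_iff]
  intro r hr
  rw [Module.mem_annihilator] at hr
  exact hC.bij.1 (by ext x; simpa using hr x)

lemma SemiDual.subsingleton_of_hom [IsNoetherianRing R] (hC : SemiDual R C) {K : Type u}
    [AddCommGroup K] [Module R K] [Subsingleton (C →ₗ[R] K)] : Subsingleton K := by
  have := hC.finite
  refine subsingleton_of_forall_eq 0 fun x => ?_
  have : Subsingleton (C →ₗ[R] (R ∙ x)) := subsingleton_of_forall_eq 0 fun f => by
    ext c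
    exact LinearMap.congr_fun
      (Subsingleton.elim ((R ∙ x).subtype ∘ₗ f : C →ₗ[R] K) 0) c
  obtain ⟨r, hr, hreg⟩ := IsSMulRegular.subsingleton_linearMap_iff.1 this
  rw [hC.annihilator] at hr
  obtain rfl : r = 0 := hr
  have : (⟨x, Submodule.mem_span_singleton_self x⟩ : R ∙ x) = 0 := hreg (by simp)
  exact congrArg Subtype.val this

lemma torsFree_of_indZero [IsNoetherianRing R] (hC : SemiDual R C) {N : Type u}
    [AddCommGroup N] [Module R N] (h : IndZero a 0 (C →ₗ[R] N)) : TorsFree a N := by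
  have := hC.finite
  have : Subsingleton (C →ₗ[R] Gam a N) := subsingleton_of_forall_eq 0 fun f => by
    have h1 := map_mem_gam (homPost C (Gam a N).subtype) ((isTors_gam (a := a) N).hom f)
    rw [h.gam_eq_bot] at h1
    ext c
    exact LinearMap.congr_fun ((Submodule.mem_bot R).1 h1) c
  have := hC.subsingleton_of_hom (K := Gam a N)
  exact fun x hx => congrArg Subtype.val (Subsingleton.elim (⟨x, hx⟩ : Gam a N) 0)

/-- `N` behaves like a `j`-th cosyzygy of `C` whose injective terms have no `a`-torsion. -/
structure Cosyz (a : Ideal R) (C H : Type u) [AddCommGroup C] [Module R C] [AddCommGroup H]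
    [Module R H] (m j : ℕ) (N : Type u) [AddCommGroup N] [Module R N] : Prop where
  perp : ExtPerp R C N
  shift : ∀ (X : Type u) [AddCommGroup X] [Module R X] (i : ℕ),
    Subsingleton (MExt R X C (i + 1 + j)) → Subsingleton (MExt R X N (i + 1))
  tors : ∀ (T : Type u) [AddCommGroup T] [Module R T], IsTors a T → ∀ i,
    (Subsingleton (MExt R T N i) ↔ Subsingleton (MExt R T C (i + j)))
  van : ∀ (T : Type u) [AddCommGroup T] [Module R T], IsTors a T → ∀ i < j,
    Subsingleton (MExt R T C i)
  lc : IsLC a m (C →ₗ[R] N) H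
  ind : ∀ i, i ≠ m → IndZero a i (C →ₗ[R] N)

theorem exists_cosyz [IsNoetherianRing R] (hC : SemiDual R C) {H : Type u} [AddCommGroup H]
    [Module R H] (j : ℕ) : ∀ (m : ℕ), IsLC a (m + j) R H →
    (∀ i, i ≠ m + j → IndZero a i R) → ∃ N : ModuleCat.{u} R, Cosyz a C H m j N := by
  have := hC.finite
  induction j with
  | zero =>
    intro m h1 h2
    let e := LinearEquiv.ofBijective _ hC.bij
    exact ⟨ModuleCat.of R C, hC.ext, fun X _ _ i h => h, fun T _ _ hT i => Iff.rfl,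
      fun T _ _ hT i hi => absurd hi (by omega), h1.congr e, fun i hi => (h2 i hi).congr e⟩
  | succ j ih =>
    intro m h1 h2
    obtain ⟨N, hN⟩ := ih (m + 1) (by rwa [add_assoc, add_comm 1 j])
      (fun i hi => h2 i (by omega))
    have hTF : TorsFree a N := torsFree_of_indZero hC (hN.ind 0 (by omega))
    obtain ⟨I, f, hI, hIT, hf⟩ := exists_torsFree_embedding hTF
    have s := ses_quot hf
    have := hN.perp 0
    have hs := s.homPost C
    have hv := fun (X : Type u) [AddCommGroup X] [Module R X] =>
      vanish_of_injective (R := R) (I := I) X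
    have hB := fun i => indZero_hom_torsFree (a := a) hIT i C
    have ht := fun (T : Type u) [AddCommGroup T] [Module R T] (hT : IsTors a T) =>
      ext_torsFree_injective hIT hT
    refine ⟨ModuleCat.of R (I ⧸ LinearMap.range f), fun i => ?_, fun X _ _ i h => ?_,
      fun T _ _ hT i => ?_, fun T _ _ hT i hi => ?_, hN.lc.shift hs (hB m) (hB _),
      fun i hi => (hB i).right hs (hN.ind (i + 1) (by omega))⟩
    · have := hN.perp (i + 1)
      have := hv C i
      exact s.cov_vanish₃ (i + 1)
    · have := hN.shift X (i + 1) (by rwa [show i + 1 + 1 + j = i + 1 + (j + 1) by omega])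
      have := hv X i
      exact s.cov_vanish₃ (i + 1)
    · rw [show i + (j + 1) = i + 1 + j by omega, ← hN.tors T hT (i + 1)]
      have := ht T hT
      constructor
      · intro h
        exact s.cov_vanish₁ i
      · intro h
        exact s.cov_vanish₃ i
    · rcases Nat.lt_succ_iff_lt_or_eq.1 hi with hi | rfl
      · exact hN.van T hT i hi
      · have h := hN.tors T hT 0
        rw [zero_add] at h
        rw [← h]
        have := hTF.subsingleton_hom hT
        exact (ext0 T N).toEquiv.subsingleton

end

section

variable {R : Type u} [CommRing R]
variable {C : Type u} [AddCommGroup C] [Module R C]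

lemma finId_of_subsingleton (e : ℕ) (W : Type u) [AddCommGroup W] [Module R W] [Subsingleton W] :
    FinId R e W := fun X _ _ i _ => ext_subsingleton_right X W i

lemma FinId.quot {A B D : Type u} [AddCommGroup A] [Module R A] [AddCommGroup B]
    [Module R B] [AddCommGroup D] [Module R D] {f : A →ₗ[R] B} {g : B →ₗ[R] D} (s : SES f g)
    [Module.Injective R B] {e : ℕ} (h : FinId R (e + 1) A) : FinId R e D := fun X _ _ i hi => by
  obtain ⟨i, rfl⟩ := Nat.exists_eq_succ_of_ne_zero (by omega : i ≠ 0)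
  have := h X (i + 2) (by omega)
  have := vanish_of_injective (R := R) (I := B) X i
  exact s.cov_vanish₃ (i + 1)

lemma FinId.sub {A B D : Type u} [AddCommGroup A] [Module R A] [AddCommGroup B]
    [Module R B] [AddCommGroup D] [Module R D] {f : A →ₗ[R] B} {g : B →ₗ[R] D} (s : SES f g)
    [Module.Injective R B] {e : ℕ} (h : FinId R e D) : FinId R (e + 1) A := fun X _ _ i hi => by
  obtain ⟨i, rfl⟩ := Nat.exists_eq_succ_of_ne_zero (by omega : i ≠ 0)
  have := h X i (by omega)
  have := vanish_of_injective (R := R) (I := B) X i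
  exact s.cov_vanish₁ i

lemma ExtPerp.quot {X A B D : Type u} [AddCommGroup X] [Module R X] [AddCommGroup A] [Module R A]
    [AddCommGroup B] [Module R B] [AddCommGroup D] [Module R D] {f : A →ₗ[R] B} {g : B →ₗ[R] D}
    (s : SES f g) [Module.Injective R B] (h : ExtPerp R X A) : ExtPerp R X D := fun i => by
  have := h (i + 1)
  have := vanish_of_injective (R := R) (I := B) X i
  exact s.cov_vanish₃ (i + 1)

theorem hasCoresDimLE_injective_iff (m : ℕ) : ∀ M : ModuleCat.{u} R,
    HasCoresDimLE R (fun N => Module.Injective R N) m M ↔ FinId R m M := by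
  induction m with
  | zero =>
    intro M
    constructor
    · rintro (h | h)
      · exact finId_of_subsingleton _ _
      · exact finId_zero_iff.2 h
    · exact fun h => Or.inr (finId_zero_iff.1 h)
  | succ m ih =>
    intro M
    constructor
    · rintro (h | ⟨X, f, hX, hf, h⟩)
      · exact finId_of_subsingleton _ _
      · exact ((ih _).1 h).sub (ses_quot hf)
    · intro h
      obtain ⟨E, f, hE, hf⟩ := exists_injective_embedding (R := R) M
      exact Or.inr ⟨E, f, hE, hf, (ih _).2 (h.quot (ses_quot hf))⟩

lemma SES.quotEquiv {A B D M X : Type u} [AddCommGroup A] [Module R A] [AddCommGroup B]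
    [Module R B] [AddCommGroup D] [Module R D] [AddCommGroup M] [Module R M] [AddCommGroup X]
    [Module R X] {f : A →ₗ[R] B} {g : B →ₗ[R] D} (s : SES f g) (f' : M →ₗ[R] X) (e' : M ≃ₗ[R] A)
    (e : X ≃ₗ[R] B) (h : ∀ x, e (f' x) = f (e' x)) :
    Nonempty ((X ⧸ LinearMap.range f') ≃ₗ[R] D) := by
  have hker : LinearMap.range f' = LinearMap.ker (g ∘ₗ e.toLinearMap) := by
    ext x
    constructor
    · rintro ⟨y, rfl⟩
      exact (s.exact _).2 ⟨e' y, (h y).symm⟩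
    · intro hx
      obtain ⟨y, hy⟩ := (s.exact _).1 hx
      refine ⟨e'.symm y, e.injective ?_⟩
      rw [h, LinearEquiv.apply_symm_apply, hy]
      rfl
  exact ⟨(Submodule.quotEquivOfEq _ _ hker).trans
    (LinearMap.quotKerEquivOfSurjective _ (s.surj.comp e.surjective))⟩

theorem hasCoresDimLE_cInjective_of_finId (C : ModuleCat.{u} R) (e : ℕ) :
    ∀ (M : ModuleCat.{u} R) (W : Type u) [AddCommGroup W] [Module R W] (_ : M ≃ₗ[R] (C →ₗ[R] W)),
    FinId R e W → ExtPerp R C W → HasCoresDimLE R (IsCInjective R C) e M := by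
  induction e with
  | zero =>
    intro M W _ _ e hW hCW
    exact Or.inr ⟨ModuleCat.of R W, finId_zero_iff.1 hW, ⟨e⟩⟩
  | succ m ih =>
    intro M W _ _ e hW hCW
    obtain ⟨E, f, hE, hf⟩ := exists_injective_embedding (R := R) W
    have s := ses_quot hf
    have := hCW 0
    have hs := s.homPost C
    refine Or.inr ⟨ModuleCat.of R (C →ₗ[R] E), homPost C f ∘ₗ e.toLinearMap,
      ⟨E, hE, ⟨LinearEquiv.refl R _⟩⟩, hs.inj.comp e.injective, ?_⟩
    obtain ⟨e₂⟩ := hs.quotEquiv (X := C →ₗ[R] E) (homPost C f ∘ₗ e.toLinearMap) e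
      (LinearEquiv.refl R _) fun _ => rfl
    exact ih _ _ e₂ (hW.quot s) (hCW.quot s)

theorem finId_of_hasCoresDimLE_cInjective [IsNoetherianRing R] {C : ModuleCat.{u} R}
    (hC : SemiDual R C) {b : ℕ} (m : ℕ) :
    ∀ (M : ModuleCat.{u} R) (W : Type u) [AddCommGroup W] [Module R W] (_ : M ≃ₗ[R] (C →ₗ[R] W)),
    FinId R b W → ExtPerp R C W → HasCoresDimLE R (IsCInjective R C) m M → FinId R m W := by
  have triv : ∀ (n : ℕ) (M : ModuleCat.{u} R) (W : Type u) [AddCommGroup W] [Module R W]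
      (_ : M ≃ₗ[R] (C →ₗ[R] W)), Subsingleton M → FinId R n W := by
    intro n M W _ _ e h
    have := e.symm.toEquiv.subsingleton
    have := hC.subsingleton_of_hom (K := W)
    exact finId_of_subsingleton _ _
  induction m with
  | zero =>
    rintro M W _ _ e hW hCW (h | ⟨I, hI, ⟨e'⟩⟩)
    · exact triv _ M W e h
    · have hE := evE_bijective hC (finId_zero_iff.2 hI) (extPerp_injective C I)
      let e₂ : W ≃ₗ[R] I := (LinearEquiv.ofBijective _ (evE_bijective hC hW hCW)).symm.trans
        ((TensorProduct.congr (LinearEquiv.refl R C) (e.symm.trans e')).trans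
          (LinearEquiv.ofBijective _ hE))
      intro X _ _ i hi
      have := finId_zero_iff.2 hI X i hi
      exact (postEquiv X e₂ i).toEquiv.subsingleton
  | succ m ih =>
    rintro M W _ _ e hW hCW (h | ⟨X, f, ⟨I, hI, ⟨e'⟩⟩, hf, h⟩)
    · exact triv _ M W e h
    · obtain ⟨φ, hφ⟩ := exists_hom_of_hom hC hW hCW
        (e'.toLinearMap ∘ₗ f ∘ₗ e.symm.toLinearMap : (C →ₗ[R] W) →ₗ[R] (C →ₗ[R] I))
      have hθ : Function.Injective (homPost C φ) := by
        rw [← hφ]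
        exact e'.injective.comp (hf.comp e.symm.injective)
      have hφi : Function.Injective φ := by
        have : Subsingleton (C →ₗ[R] LinearMap.ker φ) := subsingleton_of_forall_eq 0 fun g => by
          have : (LinearMap.ker φ).subtype ∘ₗ g = (0 : C →ₗ[R] W) := hθ (by
            ext c
            simp [homPost])
          ext c
          exact LinearMap.congr_fun this c
        have := hC.subsingleton_of_hom (K := LinearMap.ker φ)
        rw [← LinearMap.ker_eq_bot]
        exact Submodule.eq_bot_of_subsingleton
      have s := ses_quot hφi
      have := hCW 0
      obtain ⟨e₂⟩ := (s.homPost C).quotEquiv f e e' fun x => by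
        rw [← hφ]; simp
      exact (ih _ _ e₂ ((hW.mono (Nat.le_succ b)).quot s) (hCW.quot s) h).sub s

lemma le_coresDim {P : ModuleCat.{u} R → Prop} {M : ModuleCat.{u} R} {d : ℕ∞}
    (h : ∀ n : ℕ, HasCoresDimLE R P n M → d ≤ n) : d ≤ coresDim R P M :=
  le_sInf (by rintro _ ⟨n, rfl, hn⟩; exact h n hn)

lemma coresDim_le {P : ModuleCat.{u} R → Prop} {M : ModuleCat.{u} R} {n : ℕ}
    (h : HasCoresDimLE R P n M) : coresDim R P M ≤ n := sInf_le ⟨n, rfl, h⟩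

lemma exists_hasCoresDimLE {P : ModuleCat.{u} R → Prop} {M : ModuleCat.{u} R}
    (h : coresDim R P M ≠ ⊤) : ∃ n, HasCoresDimLE R P n M := by
  by_contra! hn
  exact h (top_le_iff.1 (le_coresDim fun n h => absurd h (hn n)))

lemma HasCoresDimLE.imp {P Q : ModuleCat.{u} R → Prop} (h : ∀ M, P M → Q M) (n : ℕ) :
    ∀ M : ModuleCat.{u} R, HasCoresDimLE R P n M → HasCoresDimLE R Q n M := by
  induction n with
  | zero => exact fun M => Or.imp id (h M)
  | succ n ih =>
    rintro M (hM | ⟨X, f, hX, hf, hq⟩)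
    · exact Or.inl hM
    · exact Or.inr ⟨X, f, h X hX, hf, ih _ hq⟩

end

section

variable {R : Type u} [CommRing R]

/-- A chosen injective module containing `M`. -/
def injEnv (M : ModuleCat.{u} R) : ModuleCat.{u} R := (exists_injective_embedding M).choose

/-- The chosen embedding into `injEnv M`. -/
def injEnvMap (M : ModuleCat.{u} R) : M →ₗ[R] injEnv M :=
  (exists_injective_embedding M).choose_spec.choose

instance injective_injEnv (M : ModuleCat.{u} R) : Module.Injective R (injEnv M) :=
  (exists_injective_embedding M).choose_spec.choose_spec.1

lemma injEnvMap_injective (M : ModuleCat.{u} R) : Function.Injective (injEnvMap M) :=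
  (exists_injective_embedding M).choose_spec.choose_spec.2

/-- The iterated cosyzygies of `M`. -/
def cosyz (M : ModuleCat.{u} R) : ℕ → ModuleCat.{u} R
  | 0 => M
  | j + 1 => ModuleCat.of R (injEnv (cosyz M j) ⧸ LinearMap.range (injEnvMap (cosyz M j)))

/-- The projection onto the next cosyzygy. -/
def cosyzProj (M : ModuleCat.{u} R) (j : ℕ) : injEnv (cosyz M j) →ₗ[R] cosyz M (j + 1) :=
  (LinearMap.range (injEnvMap (cosyz M j))).mkQ

lemma ses_cosyz (M : ModuleCat.{u} R) (j : ℕ) : SES (injEnvMap (cosyz M j)) (cosyzProj M j) :=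
  ses_quot (injEnvMap_injective _)

/-- Terms of the complete resolution of a `C`-injective module. -/
def resY (M : ModuleCat.{u} R) : ℤ → ModuleCat.{u} R
  | .ofNat 0 => injEnv (cosyz M 0)
  | .ofNat 1 => M
  | .ofNat (_ + 2) => ModuleCat.of R PUnit
  | .negSucc j => injEnv (cosyz M (j + 1))

/-- Differentials of the complete resolution of a `C`-injective module. -/
def resD (M : ModuleCat.{u} R) : (i : ℤ) → (resY M (i + 1) →ₗ[R] resY M i)
  | .ofNat 0 => injEnvMap (cosyz M 0)
  | .ofNat (n + 1) => (0 : PUnit.{u + 1} →ₗ[R] resY M (.ofNat (n + 1)))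
  | .negSucc 0 => injEnvMap (cosyz M 1) ∘ₗ cosyzProj M 0
  | .negSucc (j + 1) => injEnvMap (cosyz M (j + 2)) ∘ₗ cosyzProj M (j + 1)

lemma exact_comp_of_subsingleton {I A B D : Type u} [AddCommGroup I] [Module R I] [AddCommGroup A]
    [Module R A] [AddCommGroup B] [Module R B] [AddCommGroup D] [Module R D] [Subsingleton B]
    (f : A →ₗ[R] B) (g : B →ₗ[R] D) :
    Function.Exact (fun h : I →ₗ[R] A => f.comp h) (fun h : I →ₗ[R] B => g.comp h) := fun h => by
  have : Subsingleton (I →ₗ[R] B) := subsingleton_of_forall_eq 0 fun h => by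
    ext x; exact Subsingleton.elim _ _
  exact iff_of_true (by rw [Subsingleton.elim h 0]; exact LinearMap.comp_zero g)
    ⟨0, Subsingleton.elim _ _⟩

lemma exact_splice {I N E N' E' N'' E'' : Type u} [AddCommGroup I] [Module R I]
    [AddCommGroup N] [Module R N] [AddCommGroup E] [Module R E] [AddCommGroup N'] [Module R N']
    [AddCommGroup E'] [Module R E'] [AddCommGroup N''] [Module R N''] [AddCommGroup E'']
    [Module R E''] {i : N →ₗ[R] E} {p : E →ₗ[R] N'} (s : SES i p) {i' : N' →ₗ[R] E'}
    {p' : E' →ₗ[R] N''} (s' : SES i' p') {i'' : N'' →ₗ[R] E''} (hi : Function.Injective i'')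
    [Subsingleton (MExt R I N 1)] :
    Function.Exact (fun h : I →ₗ[R] E => (i' ∘ₗ p).comp h)
      (fun h : I →ₗ[R] E' => (i'' ∘ₗ p').comp h) := fun f => by
  constructor
  · intro hf
    obtain ⟨g, rfl⟩ := s'.factor f (by
      ext x
      exact hi ((LinearMap.congr_fun hf x).trans (map_zero _).symm))
    obtain ⟨g, rfl⟩ := s.lift_hom g
    exact ⟨g, rfl⟩
  · rintro ⟨g, rfl⟩
    ext x
    have : p' (i' (p (g x))) = 0 := (s'.exact _).2 ⟨_, rfl⟩
    exact (congrArg i'' this).trans (map_zero _)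

lemma exact_start {I Z M E : Type u} [AddCommGroup I] [Module R I] [AddCommGroup Z]
    [Module R Z] [AddCommGroup M] [Module R M] [AddCommGroup E] [Module R E]
    {f : M →ₗ[R] E} (hf : Function.Injective f) :
    Function.Exact (fun h : I →ₗ[R] Z => (0 : Z →ₗ[R] M).comp h)
      (fun h : I →ₗ[R] M => f.comp h) := fun g => by
  constructor
  · intro hg
    refine ⟨0, ?_⟩
    ext x
    exact (hf ((LinearMap.congr_fun hg x).trans (map_zero _).symm)).symm
  · rintro ⟨g, rfl⟩
    ext x
    exact map_zero f

lemma homExact_resD (M I : ModuleCat.{u} R) (h : ∀ j, Subsingleton (MExt R I (cosyz M j) 1))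
    (i : ℤ) : Function.Exact (fun f : I →ₗ[R] resY M (i + 1 + 1) => (resD M (i + 1)).comp f)
      (fun f : I →ₗ[R] resY M (i + 1) => (resD M i).comp f) := by
  match i with
  | .ofNat 0 => exact exact_start (injEnvMap_injective _)
  | .ofNat (n + 1) =>
    have : Subsingleton (resY M (.ofNat (n + 1) + 1)) := inferInstanceAs (Subsingleton PUnit.{u + 1})
    exact exact_comp_of_subsingleton _ _
  | .negSucc 0 =>
    intro f
    have hex := (ses_cosyz M 0)
    constructor
    · intro hf
      obtain ⟨g, hg⟩ := hex.factor (K := I) f (by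
        ext x
        exact injEnvMap_injective _ ((LinearMap.congr_fun hf x).trans (map_zero _).symm))
      exact ⟨g, hg⟩
    · rintro ⟨g, rfl⟩
      ext x
      have : cosyzProj M 0 (injEnvMap _ (g x)) = 0 := (hex.exact _).2 ⟨_, rfl⟩
      exact (congrArg (injEnvMap (cosyz M 1)) this).trans (map_zero _)
  | .negSucc 1 =>
    have := h 0
    exact exact_splice (ses_cosyz M 0) (ses_cosyz M 1) (injEnvMap_injective _)
  | .negSucc (j + 2) =>
    have := h (j + 1)
    exact exact_splice (ses_cosyz M (j + 1)) (ses_cosyz M (j + 2)) (injEnvMap_injective _)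

lemma exact_resD (M : ModuleCat.{u} R) (i : ℤ) :
    Function.Exact (resD M (i + 1)) (resD M i) := fun x => by
  have h := homExact_resD M (ModuleCat.of R R)
    (fun j => vanish_of_projective (R := R) (P := R) (cosyz M j) 0) i
    (LinearMap.toSpanSingleton R _ x)
  constructor
  · intro hx
    obtain ⟨g, hg⟩ := h.1 (by ext; simpa using hx)
    refine ⟨g (1 : R), (LinearMap.congr_fun hg (1 : R)).trans ?_⟩
    exact one_smul R x
  · rintro ⟨y, rfl⟩
    have h1 := h.2 ⟨LinearMap.toSpanSingleton R _ y, by ext; simp⟩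
    have h2 := LinearMap.congr_fun h1 (1 : R)
    simpa using h2

theorem isGCInjective_of_isCInjective [IsNoetherianRing R] {C : ModuleCat.{u} R}
    (hC : SemiDual R C) (M : ModuleCat.{u} R) (hM : IsCInjective R C M) : IsGCInjective R C M := by
  have := hC.finite
  have hext : ∀ I : ModuleCat.{u} R, IsCInjective R C I → ExtPerp R I M := by
    rintro I ⟨E, hE, ⟨e⟩⟩ i
    obtain ⟨J, hJ, ⟨e'⟩⟩ := hM
    have := ext_hom_hom (R := R) (C := C) (E := E) (I := J) i C hC.ext
    have := (postEquiv (C →ₗ[R] E) e' (i + 1)).toEquiv.subsingleton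
    exact (preEquiv M e (i + 1)).symm.toEquiv.subsingleton
  have hext' : ∀ I : ModuleCat.{u} R, IsCInjective R C I → ∀ j, ExtPerp R I (cosyz M j) := by
    intro I hI j
    induction j with
    | zero => exact hext I hI
    | succ j ih => exact ih.quot (ses_cosyz M j)
  refine ⟨⟨resY M, resD M, exact_resD M, ?_, ?_, fun I hI i =>
    homExact_resD M I (fun j => hext' I hI j 0) i⟩, ?_⟩
  · intro i hi
    match i with
    | .ofNat 0 => exact absurd hi (lt_irrefl _)
    | .ofNat 1 => exact hM
    | .ofNat (n + 2) =>
      have : Subsingleton (C →ₗ[R] PUnit.{u + 1}) := subsingleton_of_forall_eq 0 fun f => by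
        ext
      have : Subsingleton (resY M (.ofNat (n + 2))) := inferInstanceAs (Subsingleton PUnit.{u + 1})
      exact ⟨ModuleCat.of R PUnit.{u + 1}, ⟨fun _ _ _ _ _ _ _ _ _ => ⟨0, fun _ => rfl⟩⟩,
        ⟨(0 : resY M (.ofNat (n + 2)) ≃ₗ[R] (C →ₗ[R] PUnit.{u + 1}))⟩⟩
    | .negSucc j => exact absurd hi (by simp)
  · intro i hi
    match i with
    | .ofNat 0 => exact injective_injEnv _
    | .ofNat (n + 1) => exact absurd hi (by simp)
    | .negSucc j => exact injective_injEnv _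
  · change Nonempty (M ≃ₗ[R] LinearMap.ker (resD M (.negSucc 0)))
    have h : LinearMap.range (injEnvMap (cosyz M 0)) = LinearMap.ker (resD M (.negSucc 0)) := by
      ext x
      exact (exact_resD M (.negSucc 0) x).symm
    exact ⟨(LinearEquiv.ofInjective _ (injEnvMap_injective (cosyz M 0))).trans
      (LinearEquiv.ofEq _ _ h)⟩

end

section

variable {R : Type u} [CommRing R]

/-- The module `M` is killed by an element outside `q`; for finite `M` and prime `q`, this says
that the localization of `M` at `q` vanishes. -/
def Negl (q : Ideal R) (M : Type u) [AddCommGroup M] [Module R M] : Prop :=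
  ∃ s : R, s ∉ q ∧ ∀ x : M, s • x = 0

lemma Negl.mono {p q : Ideal R} {M : Type u} [AddCommGroup M] [Module R M] (h : Negl p M)
    (hqp : q ≤ p) : Negl q M := by
  obtain ⟨s, hs, h⟩ := h
  exact ⟨s, fun h => hs (hqp h), h⟩

lemma Negl.of_subsingleton {q : Ideal R} (hq : q.IsPrime) (M : Type u) [AddCommGroup M]
    [Module R M] [Subsingleton M] : Negl q M :=
  ⟨1, fun h => hq.ne_top ((Ideal.eq_top_iff_one q).2 h), fun _ => Subsingleton.elim _ _⟩

lemma Negl.mid {q : Ideal R} (hq : q.IsPrime) {A B D : Type u} [AddCommGroup A] [Module R A]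
    [AddCommGroup B] [Module R B] [AddCommGroup D] [Module R D] {f : A →ₗ[R] B} {g : B →ₗ[R] D}
    (hfg : ∀ x, g x = 0 → ∃ y, f y = x) (hA : Negl q A) (hD : Negl q D) : Negl q B := by
  obtain ⟨s, hs, hA⟩ := hA
  obtain ⟨t, ht, hD⟩ := hD
  refine ⟨s * t, fun h => (hq.mem_or_mem h).elim hs ht, fun x => ?_⟩
  obtain ⟨y, hy⟩ := hfg (t • x) (by rw [map_smul, hD])
  rw [mul_smul, ← hy, ← map_smul, hA, map_zero]

lemma Negl.congr {q : Ideal R} {A B : Type u} [AddCommGroup A] [Module R A]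
    [AddCommGroup B] [Module R B] (e : A ≃ₗ[R] B) (hA : Negl q A) : Negl q B := by
  obtain ⟨s, hs, hA⟩ := hA
  exact ⟨s, hs, fun x => e.symm.injective (by rw [map_smul, hA, map_zero])⟩

lemma Negl.of_smul_le {q : Ideal R} (hq : q.IsPrime) {L : Type u} [AddCommGroup L] [Module R L]
    [Module.Finite R L] {x s : R} (hx : x ∈ q) (hs : s ∉ q) (h : ∀ y : L, ∃ z : L, s • y = x • z) :
    Negl q L := by
  obtain ⟨p, hp, -, hc, hp0⟩ :=
    LinearMap.exists_monic_and_natDegree_eq_and_coeff_mem_pow_and_aeval_eq_zero R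
      (s • LinearMap.id : Module.End R L) (Ideal.span {x}) (by
        rintro _ ⟨y, rfl⟩
        obtain ⟨z, hz⟩ := h y
        rw [LinearMap.smul_apply, LinearMap.id_apply, hz]
        exact Submodule.smul_mem_smul (Ideal.mem_span_singleton_self x) trivial)
  refine ⟨p.eval s, fun hmem => ?_, fun y => ?_⟩
  · rw [Polynomial.eval_eq_sum_range, Finset.sum_range_succ, hp.coeff_natDegree, one_mul] at hmem
    refine hs (hq.mem_of_pow_mem _ ((Ideal.add_mem_iff_right _ ?_).1 hmem))
    refine Ideal.sum_mem _ fun k hk => Ideal.mul_mem_right _ _ ?_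
    have := Ideal.pow_le_self (by rw [Finset.mem_range] at hk; omega) (hc k)
    exact (Ideal.span_singleton_le_iff_mem q).2 hx this
  · have h1 : (s • LinearMap.id : Module.End R L) = algebraMap R (Module.End R L) s := by
      ext; simp [Module.algebraMap_end_apply]
    rw [h1, Polynomial.aeval_algebraMap_apply] at hp0
    have := LinearMap.congr_fun hp0 y
    simpa [Module.algebraMap_end_apply] using this

variable {C : Type u} [AddCommGroup C] [Module R C]

lemma smul_ext_of_kill {M : Type u} [AddCommGroup M] [Module R M] {s : R}
    (h : s ∈ Module.annihilator R M) (i : ℕ) (x : MExt R M C i) : s • x = 0 := by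
  have h0 : (s • LinearMap.id : M →ₗ[R] M) = 0 := by
    ext y
    simpa using Module.mem_annihilator.1 h y
  rw [← pre_smul_id, h0, pre_zero]

lemma annihilator_quot (r : Ideal R) : Module.annihilator R (R ⧸ r) = r := Ideal.annihilator_quotient

lemma negl_of_not_le {q r : Ideal R} (h : ¬ r ≤ q) (i : ℕ) : Negl q (MExt R (R ⧸ r) C i) := by
  obtain ⟨s, hs, hq⟩ := SetLike.not_le_iff_exists.1 h
  exact ⟨s, hq, fun x => smul_ext_of_kill (by rwa [annihilator_quot]) i x⟩

lemma negl_filtration [IsNoetherianRing R] {q : Ideal R} (hq : q.IsPrime) (i : ℕ) (J : Ideal R)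
    (hJ : ∀ r : Ideal R, r.IsPrime → J ≤ r → r ≤ q → Negl q (MExt R (R ⧸ r) C i))
    (M : Type u) [AddCommGroup M] [Module R M] [hM : Module.Finite R M]
    (hann : J ≤ Module.annihilator R M) : Negl q (MExt R M C i) := by
  revert hann
  induction hM using IsNoetherianRing.induction_on_isQuotientEquivQuotientPrime R with
  | subsingleton N =>
    intro _
    have := ext_subsingleton_left (R := R) N C i
    exact .of_subsingleton hq _
  | quotient N p e =>
    intro h
    rw [e.annihilator_eq, annihilator_quot] at h
    by_cases hp : p.1 ≤ q
    · exact (hJ p.1 p.2 h hp).congr (preEquiv C e i)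
    · exact (negl_of_not_le hp i).congr (preEquiv C e i)
  | exact A B D f g hf hg hfg hA hD =>
    intro h
    have s : SES f g := ⟨hf, hg, hfg⟩
    exact (hD (h.trans (g.annihilator_le_of_surjective hg))).mid hq
      (fun x => s.con_exact₂) (hA (h.trans (f.annihilator_le_of_injective hf)))

lemma negl_of_quot [IsNoetherianRing R] [Module.Finite R C] {q r : Ideal R} (hq : q.IsPrime)
    (hr : r.IsPrime) {x : R} (hxq : x ∈ q) (hxr : x ∉ r) (i : ℕ)
    (h : ∀ (D : Type u) [AddCommGroup D] [Module R D] [Module.Finite R D],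
      r ⊔ Ideal.span {x} ≤ Module.annihilator R D → Negl q (MExt R D C (i + 1))) :
    Negl q (MExt R (R ⧸ r) C i) := by
  have hinj : Function.Injective (x • LinearMap.id : (R ⧸ r) →ₗ[R] R ⧸ r) := by
    rw [injective_iff_map_eq_zero]
    intro y hy
    obtain ⟨y, rfl⟩ := Ideal.Quotient.mk_surjective y
    have hy' : Ideal.Quotient.mk r (x * y) = 0 := hy
    rw [Ideal.Quotient.eq_zero_iff_mem] at hy' ⊢
    exact (hr.mem_or_mem hy').resolve_left hxr
  have s := ses_quot hinj
  obtain ⟨t, ht, hD⟩ := h _ (show r ⊔ Ideal.span {x} ≤ Module.annihilator R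
      ((R ⧸ r) ⧸ LinearMap.range (x • LinearMap.id : (R ⧸ r) →ₗ[R] R ⧸ r)) by
    refine sup_le ?_ ?_
    · exact (annihilator_quot r).ge.trans
        (LinearMap.annihilator_le_of_surjective _ (Submodule.mkQ_surjective _))
    · rw [Ideal.span_singleton_le_iff_mem, Module.mem_annihilator]
      intro y
      obtain ⟨y, rfl⟩ := Submodule.mkQ_surjective _ y
      rw [← map_smul]
      exact (Submodule.Quotient.mk_eq_zero _).2 ⟨y, rfl⟩)
  have : Module.Finite R (MExt R (R ⧸ r) C i) := inferInstance
  refine .of_smul_le hq hxq ht fun y => ?_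
  obtain ⟨z, hz⟩ := s.con_exact₁ (x := t • y) (by rw [map_smul, hD])
  exact ⟨z, by rw [← hz, pre_smul_id]⟩

lemma negl_step [IsNoetherianRing R] [Module.Finite R C] {q : Ideal R} (hq : q.IsPrime) {i : ℕ}
    (h1 : ∀ (M : Type u) [AddCommGroup M] [Module R M] [Module.Finite R M],
      Negl q (MExt R M C (i + 1)))
    (h2 : Negl q (MExt R (R ⧸ q) C i)) (M : Type u) [AddCommGroup M] [Module R M]
    [Module.Finite R M] : Negl q (MExt R M C i) := by
  refine negl_filtration hq i ⊥ (fun r hr _ hrq => ?_) M bot_le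
  rcases hrq.eq_or_lt with rfl | hlt
  · exact h2
  · obtain ⟨x, hxq, hxr⟩ := SetLike.exists_of_lt hlt
    exact negl_of_quot hq hr hxq hxr i fun D _ _ _ _ => h1 D

lemma negl_adjacent [IsNoetherianRing R] [Module.Finite R C] {p q : Ideal R} (hp : p.IsPrime)
    (hq : q.IsPrime) (hlt : q < p) (hadj : ∀ r : Ideal R, r.IsPrime → q < r → r ≤ p → r = p)
    {i : ℕ} (h : Negl p (MExt R (R ⧸ p) C (i + 1))) : Negl q (MExt R (R ⧸ q) C i) := by
  obtain ⟨x, hxp, hxq⟩ := SetLike.exists_of_lt hlt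
  refine (negl_of_quot hp hq hxp hxq i fun D _ _ _ hD => ?_).mono hlt.le
  refine negl_filtration hp (i + 1) (q ⊔ Ideal.span {x}) (fun r hr hJ hrp => ?_) D hD
  obtain rfl : r = p := hadj r hr (lt_of_le_of_ne (le_sup_left.trans hJ) (by
    rintro rfl
    exact hxq (hJ (Ideal.mem_sup_right (Ideal.mem_span_singleton_self x))))) hrp
  exact h

theorem not_negl_height [IsNoetherianRing R] [Module.Finite R C]
    (hC : Module.annihilator R C = ⊥) (h : ℕ) : ∀ p : Ideal R, p.IsPrime → p.height = h →
    ¬ Negl p (MExt R (R ⧸ p) C h) := by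
  induction h with
  | zero =>
    intro p hp hh hN
    rw [Nat.cast_zero, Ideal.height_eq_zero_iff] at hh
    have hmem : p ∈ (Module.annihilator R C).minimalPrimes := by rw [hC]; exact hh
    have hass := Module.associatedPrimes.minimalPrimes_annihilator_subset_associatedPrimes R C hmem
    obtain ⟨-, c, hc⟩ := isAssociatedPrime_iff.1 hass
    have hc' : ∀ r, r ∈ p ↔ r • c = 0 := fun r => by
      rw [hc]; simp [Submodule.mem_colon_singleton]
    obtain ⟨s, hs, hk⟩ := hN
    let f : (R ⧸ p) →ₗ[R] C := Submodule.liftQ p (LinearMap.toSpanSingleton R C c) (by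
      intro r hr
      simpa using (hc' r).1 hr)
    have h1 : s • f = 0 := by
      have := congrArg (ext0 (R := R) (R ⧸ p) C) (hk ((ext0 (R ⧸ p) C).symm f))
      rwa [map_smul, LinearEquiv.apply_symm_apply, map_zero] at this
    have h2 := LinearMap.congr_fun h1 (Submodule.Quotient.mk 1)
    have hf : f (Submodule.Quotient.mk 1) = c :=
      (Submodule.liftQ_apply _ _ _).trans (one_smul R c)
    rw [LinearMap.smul_apply, hf] at h2
    exact hs ((hc' s).2 h2)
  | succ h ih =>
    intro p hp hh hN
    have h1 := PrimeSpectrum.height_eq_orderHeight (⟨p, hp⟩ : PrimeSpectrum R)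
    rw [hh] at h1
    obtain ⟨-, ⟨q, hqp, hqh⟩, -⟩ := Order.height_eq_coe_add_one_iff.1 (by
      rw [← h1]; push_cast; rfl)
    rw [← PrimeSpectrum.height_eq_orderHeight] at hqh
    have hlt : q.asIdeal < p := hqp
    refine ih q.asIdeal q.2 hqh (negl_adjacent hp q.2 hlt (fun r hr hqr hrp => ?_) hN)
    by_contra hne
    have ha := Ideal.height_add_one_le_of_lt_of_isPrime hqr
    have hb := Ideal.height_add_one_le_of_lt_of_isPrime (lt_of_le_of_ne hrp hne)
    rw [hqh] at ha
    rw [hh] at hb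
    have := (add_le_add_left ha 1).trans hb
    norm_cast at this
    omega

end

section

variable {R : Type u} [CommRing R] {a : Ideal R}
variable {C : Type u} [AddCommGroup C] [Module R C]

lemma isTors_quot_of_le {r : Ideal R} (h : a ≤ r) : IsTors a (R ⧸ r) := by
  refine isTors_of_killed 1 fun s hs x => ?_
  rw [pow_one] at hs
  obtain ⟨x, rfl⟩ := Submodule.Quotient.mk_surjective _ x
  rw [← Submodule.Quotient.mk_smul, Submodule.Quotient.mk_eq_zero]
  exact Ideal.mul_mem_right _ _ (h hs)

theorem le_height_of_vanish [IsNoetherianRing R] [Module.Finite R C]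
    (hC : Module.annihilator R C = ⊥) {j : ℕ}
    (hv : ∀ (T : Type u) [AddCommGroup T] [Module R T], IsTors a T → ∀ i < j,
      Subsingleton (MExt R T C i)) {p : Ideal R} (hp : p.IsPrime) (hap : a ≤ p) :
    (j : ℕ∞) ≤ p.height := by
  obtain ⟨h, hh⟩ := ENat.ne_top_iff_exists.1 (Ideal.height_ne_top (I := p) hp.ne_top)
  rw [← hh]
  by_contra! hlt
  have := hv _ (isTors_quot_of_le hap) h (by exact_mod_cast hlt)
  exact not_negl_height hC h p hp hh.symm (.of_subsingleton hp _)

lemma exists_hom_ne_zero [IsNoetherianRing R] (m : ℕ) : ∀ (j : ℕ) (D : Type u) [AddCommGroup D]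
    [Module R D] [Module.Finite R D], (∀ i < m, Subsingleton (MExt R (R ⧸ a) D i)) →
    ¬ Subsingleton (MExt R (R ⧸ a) D m) → (∀ i, j < i → Subsingleton (MExt R D C i)) →
    ∃ D' : ModuleCat.{u} R, Module.Finite R D' ∧ ¬ Subsingleton ((R ⧸ a) →ₗ[R] D') ∧
      ∀ i, j + m < i → Subsingleton (MExt R D' C i) := by
  induction m with
  | zero =>
    intro j D _ _ _ _ h2 h3
    refine ⟨ModuleCat.of R D, ‹_›, fun h => h2 ?_, h3⟩
    exact (ext0 (R ⧸ a) D).toEquiv.subsingleton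
  | succ m ih =>
    intro j D _ _ _ h1 h2 h3
    have := h1 0 (by omega)
    have : Subsingleton ((R ⧸ a) →ₗ[R] D) := (ext0 (R ⧸ a) D).symm.toEquiv.subsingleton
    obtain ⟨x, hx, hreg⟩ := IsSMulRegular.subsingleton_linearMap_iff.1 this
    have hinj : Function.Injective (x • LinearMap.id : D →ₗ[R] D) := hreg
    have s := ses_quot hinj
    have hQ1 : ∀ i < m, Subsingleton (MExt R (R ⧸ a)
        (D ⧸ LinearMap.range (x • LinearMap.id : D →ₗ[R] D)) i) := fun i hi => by
      have := h1 i (by omega)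
      have := h1 (i + 1) (by omega)
      exact s.cov_vanish₃ i
    have hQ2 : ¬ Subsingleton (MExt R (R ⧸ a)
        (D ⧸ LinearMap.range (x • LinearMap.id : D →ₗ[R] D)) m) := fun h => by
      refine h2 (subsingleton_of_forall_eq 0 fun y => ?_)
      obtain ⟨z, rfl⟩ := s.cov_exact₁ (x := y) (by
        rw [post_smul_id]
        exact smul_ext_of_kill hx _ _)
      rw [Subsingleton.elim z 0, map_zero]
    obtain ⟨D', hD, hne, hv⟩ := ih (j + 1) _ hQ1 hQ2 (fun i hi => by
      obtain ⟨i, rfl⟩ := Nat.exists_eq_succ_of_ne_zero (by omega : i ≠ 0)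
      have := h3 i (by omega)
      have := h3 (i + 1) (by omega)
      exact s.con_vanish₃ i)
    exact ⟨D', hD, hne, fun i hi => hv i (by omega)⟩

theorem exists_height_le_of_ne [IsNoetherianRing R] [Module.Finite R C]
    (hC : Module.annihilator R C = ⊥) (hCC : ExtPerp R C C) {d : ℕ} (hd : FinId R d C) {j : ℕ}
    (hv : ∀ i < j, Subsingleton (MExt R (R ⧸ a) C i))
    (hne : ¬ Subsingleton (MExt R (R ⧸ a) C j)) :
    ∃ q : Ideal R, q.IsPrime ∧ a ≤ q ∧ q.height ≤ j := by
  obtain ⟨D, hD, hDne, hDv⟩ := exists_hom_ne_zero (a := a) (C := C) j 0 C hv hne (fun i hi => by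
    obtain ⟨i, rfl⟩ := Nat.exists_eq_succ_of_ne_zero (by omega : i ≠ 0)
    exact hCC i)
  rw [zero_add] at hDv
  obtain ⟨f, hf⟩ : ∃ f : (R ⧸ a) →ₗ[R] D, f ≠ 0 := by
    by_contra! h
    exact hDne (subsingleton_of_forall_eq 0 h)
  have : Nontrivial (LinearMap.range f) := by
    rwa [Submodule.nontrivial_iff_ne_bot, Ne, LinearMap.range_eq_bot]
  obtain ⟨q, hq⟩ := associatedPrimes.nonempty R (LinearMap.range f)
  obtain ⟨hqp, g, hg⟩ := (isAssociatedPrime_iff_exists_injective_linearMap _ _).1 hq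
  have haq : a ≤ q := fun r hr => by
    rw [← Ideal.Quotient.eq_zero_iff_mem]
    apply hg
    rw [map_zero]
    have h1 : (Ideal.Quotient.mk q r : R ⧸ q) = r • Submodule.Quotient.mk 1 := by
      rw [← Submodule.Quotient.mk_smul, smul_eq_mul, mul_one]; rfl
    rw [h1, map_smul]
    obtain ⟨y, hy⟩ := (g (Submodule.Quotient.mk 1)).2
    refine Subtype.ext ?_
    rw [Submodule.coe_smul, ← hy, ← map_smul, Module.mem_annihilator.1
      (by rwa [annihilator_quot]) y, map_zero]
    rfl
  refine ⟨q, hqp, haq, ?_⟩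
  have s := ses_quot (f := (LinearMap.range f).subtype ∘ₗ g)
    ((Submodule.subtype_injective _).comp hg)
  have key : ∀ k i, j < i → d < i + k → ∀ (M : Type u) [AddCommGroup M] [Module R M]
      [Module.Finite R M], Negl q (MExt R M C i) := by
    intro k
    induction k with
    | zero =>
      intro i _ hi M _ _ _
      have := hd M i hi
      exact .of_subsingleton hqp _
    | succ k ih =>
      intro i hi hik
      have h1 := fun (M : Type u) [AddCommGroup M] [Module R M] [Module.Finite R M] =>
        ih (i + 1) (by omega) (by omega) M
      refine fun M _ _ _ => negl_step hqp h1 ?_ M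
      have := hDv i hi
      exact Negl.mid hqp (fun x => s.con_exact₁) (.of_subsingleton hqp _) (h1 _)
  obtain ⟨h, hh⟩ := ENat.ne_top_iff_exists.1 (Ideal.height_ne_top (I := q) hqp.ne_top)
  rw [← hh]
  by_contra! hlt
  exact not_negl_height hC h q hqp hh.symm
    (key (d + 1) h (by exact_mod_cast hlt) (by omega) (R ⧸ q))

lemma moduleKrullDim_localization (p : PrimeSpectrum R) :
    moduleKrullDim (Localization.AtPrime p.asIdeal)
      (LocalizedModule p.asIdeal.primeCompl R) = p.asIdeal.height := by
  have h0 : Module.annihilator (Localization.AtPrime p.asIdeal)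
      (LocalizedModule p.asIdeal.primeCompl R) = ⊥ := by
    rw [eq_bot_iff]
    intro r hr
    have h1 := Module.mem_annihilator.1 hr (LocalizedModule.mk 1 1)
    induction r using Localization.induction_on with | _ y
    obtain ⟨x, s⟩ := y
    rw [LocalizedModule.mk_smul_mk, ← LocalizedModule.zero_mk 1, LocalizedModule.mk_eq] at h1
    obtain ⟨t, ht⟩ := h1
    rw [Submodule.mem_bot, Localization.mk_eq_mk', IsLocalization.mk'_eq_zero_iff]
    refine ⟨t, ?_⟩
    simpa [Submonoid.smul_def] using ht
  rw [moduleKrullDim, h0, ringKrullDim_eq_of_ringEquiv (RingEquiv.quotientBot _),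
    IsLocalization.AtPrime.ringKrullDim_eq_height p.asIdeal]

lemma mem_support_quot (p : PrimeSpectrum R) :
    p ∈ Module.support R (R ⧸ (a • (⊤ : Submodule R R))) ↔ a ≤ p.asIdeal := by
  have h : a • (⊤ : Submodule R R) = a := by simp
  rw [h, Module.support_eq_zeroLocus, annihilator_quot, PrimeSpectrum.mem_zeroLocus]
  rfl

theorem heightWRT_eq {j : ℕ}
    (h1 : ∀ p : Ideal R, p.IsPrime → a ≤ p → (j : ℕ∞) ≤ p.height)
    (h2 : ∃ q : Ideal R, q.IsPrime ∧ a ≤ q ∧ q.height ≤ j) :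
    heightWRT R a R = ((j : ℕ∞) : WithBot ℕ∞) := by
  rw [heightWRT]
  refine le_antisymm ?_ (le_iInf₂ fun p hp => ?_)
  · obtain ⟨q, hq, haq, hj⟩ := h2
    refine (iInf₂_le (⟨q, hq⟩ : PrimeSpectrum R) ((mem_support_quot _).2 haq)).trans ?_
    rw [moduleKrullDim_localization]
    exact WithBot.coe_le_coe.2 hj
  · rw [moduleKrullDim_localization]
    exact WithBot.coe_le_coe.2 (h1 p.asIdeal p.2 ((mem_support_quot _).1 hp))

lemma finId_zero_of_ideal {M : Type u} [AddCommGroup M] [Module R M]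
    (h : ∀ I : Ideal R, Subsingleton (MExt R (R ⧸ I) M 1)) : FinId R 0 M := by
  rw [finId_zero_iff]
  refine Module.Baer.injective fun I g => ?_
  have s : SES (Submodule.subtype I) (Submodule.mkQ I) := ses_sub I
  have := h I
  obtain ⟨g', hg'⟩ := s.extend_hom g
  exact ⟨g', fun x hx => LinearMap.congr_fun hg' ⟨x, hx⟩⟩

theorem finId_of_ideal (e : ℕ) : ∀ (M : Type u) [AddCommGroup M] [Module R M],
    (∀ I : Ideal R, Subsingleton (MExt R (R ⧸ I) M (e + 1))) → FinId R e M := by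
  induction e with
  | zero => exact fun M _ _ h => finId_zero_of_ideal h
  | succ e ih =>
    intro M _ _ h
    obtain ⟨E, f, hE, hf⟩ := exists_injective_embedding (R := R) M
    have s := ses_quot hf
    refine FinId.sub s (ih _ fun I => ?_)
    have := h I
    have := vanish_of_injective (R := R) (I := E) (R ⧸ I) e
    exact s.cov_vanish₃ (e + 1)

theorem exists_min_finId [IsNoetherianRing R] [IsLocalRing R] [Module.Finite R C]
    (hC : Module.annihilator R C = ⊥) (h : ∃ d, FinId R d C) :
    ∃ d, FinId R d C ∧ (∀ e, FinId R e C → d ≤ e) ∧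
      ¬ Subsingleton (MExt R (R ⧸ IsLocalRing.maximalIdeal R) C d) := by
  classical
  refine ⟨Nat.find h, Nat.find_spec h, fun e he => Nat.find_min' h he, fun hs => ?_⟩
  have hm : (IsLocalRing.maximalIdeal R).IsPrime := inferInstance
  have hall : ∀ (M : Type u) [AddCommGroup M] [Module R M] [Module.Finite R M],
      Subsingleton (MExt R M C (Nat.find h)) := fun M _ _ _ => by
    obtain ⟨s, hs, hk⟩ := negl_step hm (i := Nat.find h) (C := C) (fun M _ _ _ => by
      have := Nat.find_spec h M (Nat.find h + 1) (by omega)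
      exact .of_subsingleton hm _) (.of_subsingleton hm _) M
    have hu : IsUnit s := by simpa using hs
    exact subsingleton_of_forall_eq 0 fun x => (hu.smul_eq_zero).1 (hk x)
  rcases Nat.eq_zero_or_eq_succ_pred (Nat.find h) with h0 | h0
  · have := hall R
    rw [h0] at this
    have : Subsingleton (R →ₗ[R] C) := (ext0 R C).symm.toEquiv.subsingleton
    have : Subsingleton C := (LinearMap.ringLmapEquivSelf R R C).symm.toEquiv.subsingleton
    have h1 : (1 : R) ∈ Module.annihilator R C :=
      Module.mem_annihilator.2 fun _ => Subsingleton.elim _ _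
    rw [hC] at h1
    exact one_ne_zero h1
  · refine Nat.find_min h (m := (Nat.find h).pred) (by omega) (finId_of_ideal _ C fun I => ?_)
    have := hall (R ⧸ I)
    rwa [h0] at this

end

section

variable {R : Type u} [CommRing R] {a : Ideal R}

/-- Torsion of a `Hom` module out of a finite module. -/
def gamHomEquiv (C N : Type u) [AddCommGroup C] [Module R C] [Module.Finite R C] [AddCommGroup N]
    [Module R N] : Gam a (C →ₗ[R] N) ≃ₗ[R] (C →ₗ[R] Gam a N) :=
  .ofBijective
    { toFun f := f.1.codRestrict _ fun c => map_mem_gam (LinearMap.applyₗ c) f.2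
      map_add' _ _ := rfl
      map_smul' _ _ := rfl }
    ⟨fun _ _ h => Subtype.ext (LinearMap.ext fun c =>
      congrArg Subtype.val (LinearMap.congr_fun h c)),
      fun g => ⟨⟨(Gam a N).subtype ∘ₗ g,
        map_mem_gam (homPost C (Gam a N).subtype) ((isTors_gam (a := a) N).hom g)⟩, rfl⟩⟩

lemma torsFree_of_subsingleton_hom {N : Type u} [AddCommGroup N] [Module R N]
    [Subsingleton ((R ⧸ a) →ₗ[R] N)] : TorsFree a N := by
  have h0 : ∀ x : N, (∀ r ∈ a, r • x = 0) → x = 0 := fun x hx => by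
    let f : (R ⧸ a) →ₗ[R] N := Submodule.liftQ a (LinearMap.toSpanSingleton R N x)
      fun r hr => by simpa using hx r hr
    have hf : f (Submodule.Quotient.mk 1) = x := (Submodule.liftQ_apply _ _ _).trans (one_smul R x)
    rw [← hf, Subsingleton.elim f 0, LinearMap.zero_apply]
  rintro x ⟨t, ht⟩
  induction t generalizing x with
  | zero => simpa using ht 1 (by simp)
  | succ t ih =>
    refine ih x fun r hr => h0 _ fun s hs => ?_
    rw [smul_smul, mul_comm]
    exact ht _ (by rw [pow_succ]; exact Ideal.mul_mem_mul hr hs)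

lemma injDim_eq {C : ModuleCat.{u} R} {d : ℕ} (h : FinId R d C) (hmin : ∀ e, FinId R e C → d ≤ e) :
    injDim R C = d :=
  le_antisymm (coresDim_le ((hasCoresDimLE_injective_iff d C).2 h))
    (le_coresDim fun n hn => by
      exact_mod_cast hmin n ((hasCoresDimLE_injective_iff n C).1 hn))

theorem SemiDual.dimensions [IsNoetherianRing R] [IsLocalRing R] {C : ModuleCat.{u} R}
    (hC : SemiDual R C) (hfin : ∃ d, FinId R d C) (H : ModuleCat.{u} R) [Nontrivial H] (j : ℕ)
    (h1 : IsLC a j R H) (h2 : ∀ i, i ≠ j → IndZero a i R) :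
    ∃ d : ℕ, injDim R C = d ∧ HasCoresDimLE R (IsCInjective R C) (d - j) H ∧
      cinjDim R C H = (d - j : ℕ) ∧ heightWRT R a R = ((j : ℕ∞) : WithBot ℕ∞) := by
  have := hC.finite
  obtain ⟨d, hd, hmin, hne⟩ := exists_min_finId hC.annihilator hfin
  obtain ⟨N, hN⟩ := exists_cosyz hC j 0 (by rwa [zero_add]) (by rwa [zero_add])
  obtain ⟨e⟩ := hN.lc.equivGam
  have e' := e ≪≫ₗ gamHomEquiv C N
  have hNd : FinId R (d - j) N := fun X _ _ i hi => by
    obtain ⟨i, rfl⟩ := Nat.exists_eq_succ_of_ne_zero (by omega : i ≠ 0)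
    exact hN.shift X i (hd X _ (by omega))
  obtain ⟨hW, hCW, hsurj⟩ := gam_finId hC (d - j) N hNd hN.perp fun i => hN.ind _ (by omega)
  have hup := hasCoresDimLE_cInjective_of_finId C (d - j) H (Gam a N) e' hW hCW
  have hext : ¬ Subsingleton (MExt R (R ⧸ a) C j) := fun hs => by
    have := (hN.tors (R ⧸ a) (isTors_quot_of_le le_rfl) 0).2 (by rwa [zero_add])
    have : Subsingleton ((R ⧸ a) →ₗ[R] N) := (ext0 (R ⧸ a) N).symm.toEquiv.subsingleton
    have hTF : TorsFree a N := torsFree_of_subsingleton_hom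
    have : Subsingleton (Gam a N) :=
      subsingleton_of_forall_eq 0 fun x => Subtype.ext (hTF x.1 x.2)
    have : Subsingleton H := e'.toEquiv.subsingleton
    exact not_subsingleton H this
  have hmax : a ≤ IsLocalRing.maximalIdeal R := IsLocalRing.le_maximalIdeal (by
    rintro rfl
    have : Subsingleton (R ⧸ (⊤ : Ideal R)) := Ideal.Quotient.subsingleton_iff.2 rfl
    exact hext (ext_subsingleton_left _ _ _))
  have hk := isTors_quot_of_le hmax
  refine ⟨d, injDim_eq hd hmin, hup, le_antisymm (coresDim_le hup) (le_coresDim fun m hm => ?_), ?_⟩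
  · by_contra! hlt
    have hlt : m < d - j := by exact_mod_cast hlt
    have hWm := finId_of_hasCoresDimLE_cInjective hC m H (Gam a N) e' hW hCW hm
    have := hWm (R ⧸ IsLocalRing.maximalIdeal R) (d - j) hlt
    have := (hN.tors _ hk (d - j)).1 (hsurj _ hk (d - j)).subsingleton
    rw [Nat.sub_add_cancel (by omega)] at this
    exact hne this
  · exact heightWRT_eq (fun p hp => le_height_of_vanish hC.annihilator hN.van hp)
      (exists_height_le_of_ne hC.annihilator hC.ext hd
        (fun i hi => hN.van _ (isTors_quot_of_le le_rfl) i hi) hext)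

lemma IsSemidualizing.semiDual {C : ModuleCat.{u} R} (hC : IsSemidualizing R C) :
    SemiDual R C where
  finite := hC.1
  bij := hC.2.1
  ext i := by
    have := hC.2.2 (i + 1) (by omega)
    exact (extCompare C (i + 1) C).symm.toEquiv.subsingleton

end

end RelCM

end

noncomputable section
open CategoryTheory TensorProduct

/-- Over a local ring with a dualizing module, if `C` is a dualizing
(semidualizing with finite injective dimension) module, then for every ideal `a` with
respect to which `R` is relative Cohen-Macaulay with `ht_R(a) = n`, `G_C-id_R H_a^n(R)`
is finite and `C-id_R H_a^n(R) = id_R C - n`. -/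
theorem stmt_19 (R : Type u) [CommRing R] [IsNoetherianRing R] [IsLocalRing R]
    (hdual : ∃ D : ModuleCat.{u} R, IsDualizing R D)
    (C : ModuleCat.{u} R) (hC : IsSemidualizing R C) (hCfin : injDim R C ≠ ⊤)
    (a : Ideal R) (n : ℕ) (hRCM : IsRelativeCM R a (ModuleCat.of R R))
    (hht : heightWRT R a R = ((n : ℕ∞) : WithBot ℕ∞)) :
    gcinjDim R C ((localCohomology a n).obj (ModuleCat.of R R)) ≠ ⊤ ∧
    cinjDim R C ((localCohomology a n).obj (ModuleCat.of R R)) = injDim R C - (n : ℕ∞) := by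
  have hS := RelCM.IsSemidualizing.semiDual hC
  obtain ⟨j, hj, huniq⟩ := hRCM
  obtain ⟨b, hb⟩ := RelCM.exists_hasCoresDimLE hCfin
  have hj : Nontrivial ((localCohomology a j).obj (ModuleCat.of R R)) := hj
  obtain ⟨d, hd, hup, hdim, hh⟩ := hS.dimensions
    ⟨b, (RelCM.hasCoresDimLE_injective_iff b C).1 hb⟩ _ j
    (RelCM.isLC_localCohomology a j R) fun i hi => by
      have : Subsingleton ((localCohomology a i).obj (ModuleCat.of R R)) :=
        not_nontrivial_iff_subsingleton.1 fun h => hi (huniq i h)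
      exact (RelCM.isLC_localCohomology a i R).indZero
  obtain rfl : n = j := by
    rw [hh] at hht
    exact_mod_cast hht.symm
  refine ⟨ne_top_of_le_ne_top (ENat.natCast_ne_top _) (RelCM.coresDim_le
    (RelCM.HasCoresDimLE.imp (RelCM.isGCInjective_of_isCInjective hS) _ _ hup)), ?_⟩
  rw [hdim, hd]
  exact ENat.natCast_sub d n

end
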